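/- arXiv:1501.00827 — 2 statements merged into one kernel-verified Lean document; each statement's English description precedes it below -/
import Mathlib

section
/- There exists a sequence of complex coefficients (C_k) for k ∈ ℤ with C_{-k} = conj(C_k), such that ∑_k |C_k|^q < ∞ for every q > 2, and for every ε > 0 there exists a measurable weight function μ : [0,2π] → ℝ with 0 < μ(x) ≤ 1, |{x ∈ [0,2π] : μ(x) ≠ 1}| < ε, so that for every f with ∫_0^{2π} |f| μ < ∞ there is a bijection σ : ℕ → ℤ such that the rearranged partial sums ∑_{j≤n} C_{σ(j)} e^{i σ(j) x} converge to f in the weighted L¹ norm ∫_0^{2π} |·| μ dx. -/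
open MeasureTheory Real Complex Set Filter

lemma exists_p (δ : ℝ) (hδ : 0 < δ) : ∃ p : Polynomial ℂ, p.coeff 0 = 0 ∧
    volume {x ∈ Ioc (0:ℝ) (2*π) | ¬ ((p.eval (Complex.exp (Complex.I * x))).re ≤ -(1/4))} ≤ ENNReal.ofReal δ := by
  let P : ℕ → Polynomial ℂ := fun n => Polynomial.C ((1:ℂ)/n) *
    ∑ j ∈ Finset.range n, ∑ k ∈ Finset.range j, (Polynomial.X)^(k+1)
  have hP0 : ∀ n, (P n).coeff 0 = 0 := by
    intro n
    simp [P, Polynomial.coeff_X_pow]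
  have hev : ∀ n : ℕ, 0 < n → ∀ z : ℂ, z ≠ 1 → (P n).eval z =
      z/(1-z) - (z/(1-z)) * ((z^n-1)/(z-1)) * (1/n) := by
    intro n hn z hz
    have hz' : z - 1 ≠ 0 := sub_ne_zero.mpr hz
    have hz'' : 1 - z ≠ 0 := sub_ne_zero.mpr hz.symm
    have hn' : (n:ℂ) ≠ 0 := by exact_mod_cast hn.ne'
    have h1 : ∀ j, ∑ k ∈ Finset.range j, z^(k+1) = z * ((z^j-1)/(z-1)) := by
      intro j
      rw [← geom_sum_eq hz, Finset.mul_sum]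
      exact Finset.sum_congr rfl fun k _ => by ring
    have h2 : ∑ j ∈ Finset.range n, z * ((z^j-1)/(z-1)) = z/(z-1) * ((z^n-1)/(z-1) - n) := by
      rw [← geom_sum_eq hz]
      rw [show (n:ℂ) = ∑ j ∈ Finset.range n, (1:ℂ) by simp, ← Finset.sum_sub_distrib, Finset.mul_sum]
      exact Finset.sum_congr rfl fun k _ => by ring
    simp only [P, Polynomial.eval_mul, Polynomial.eval_C, Polynomial.eval_finsetSum,
      Polynomial.eval_pow, Polynomial.eval_X, h1, h2]
    rw [show z - 1 = -(1-z) by ring]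
    field_simp
    ring
  let ν := volume.restrict (Ioo (0:ℝ) (2*π))
  let F : ℕ → ℝ → ℂ := fun n x => (P n).eval (Complex.exp (Complex.I * x))
  let g : ℝ → ℂ := fun x => Complex.exp (Complex.I * x) / (1 - Complex.exp (Complex.I * x))
  have hne : ∀ x ∈ Ioo (0:ℝ) (2*π), Complex.exp (Complex.I * x) ≠ 1 := by
    intro x hx h
    rw [Complex.exp_eq_one_iff] at h
    obtain ⟨m, hm⟩ := h
    have h3 : (x:ℂ) = m * (2*π) := by
      have : Complex.I * (x:ℂ) = Complex.I * (m * (2*π)) := by rw [hm]; ring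
      exact mul_left_cancel₀ Complex.I_ne_zero this
    have h4 : x = m * (2*π) := by exact_mod_cast h3
    have hpi := Real.pi_pos
    have h5 : (0:ℝ) < m := by
      by_contra hcon
      push Not at hcon
      nlinarith [hx.1]
    have h6 : (m:ℝ) < 1 := by
      by_contra hcon
      push Not at hcon
      nlinarith [hx.2]
    have h7 : (0:ℤ) < m := by exact_mod_cast h5
    have h8 : m < (1:ℤ) := by exact_mod_cast h6
    omega
  have hnorm : ∀ x : ℝ, ‖Complex.exp (Complex.I * x)‖ = 1 := by
    intro x
    rw [mul_comm]; exact Complex.norm_exp_ofReal_mul_I x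
  have hlim : ∀ᵐ x ∂ν, Tendsto (fun n => F n x) atTop (nhds (g x)) := by
    refine (ae_restrict_iff' measurableSet_Ioo).2 (ae_of_all _ ?_)
    intro x hx
    have hz := hne x hx
    set z := Complex.exp (Complex.I * x) with hzdef
    have h1 : Tendsto (fun n : ℕ => (z/(1-z)) * ((z^n-1)/(z-1)) * (1/(n:ℂ))) atTop (nhds 0) := by
      apply squeeze_zero_norm (a := fun n : ℕ => (‖z/(1-z)‖ * (2/‖z-1‖)) * (1/(n:ℝ)))
      · intro n
        rw [norm_mul, norm_mul, norm_div (z^n-1)]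
        have : ‖z^n-1‖ ≤ 2 := by
          refine (norm_sub_le _ _).trans ?_
          rw [norm_pow, hnorm x]; norm_num
        have h2 : ‖(1/(n:ℂ))‖ = 1/(n:ℝ) := by simp
        rw [h2]
        gcongr
      · have := tendsto_one_div_atTop_nhds_zero_nat (𝕜 := ℝ)
        simpa using this.const_mul (‖z/(1-z)‖ * (2/‖z-1‖))
    have h3 : Tendsto (fun n : ℕ => z/(1-z) - (z/(1-z)) * ((z^n-1)/(z-1)) * (1/(n:ℂ))) atTop (nhds (z/(1-z))) := by
      simpa using h1.const_sub (z/(1-z))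
    refine h3.congr' ?_
    filter_upwards [eventually_gt_atTop 0] with n hn
    exact (hev n hn z hz).symm
  have hre : ∀ x ∈ Ioo (0:ℝ) (2*π), (g x).re = -(1/2) := by
    intro x hx
    have hz := hne x hx
    have hn := hnorm x
    simp only [g]
    set z := Complex.exp (Complex.I * x) with hzdef
    have hz'' : 1 - z ≠ 0 := sub_ne_zero.mpr hz.symm
    have h1 : Complex.normSq z = 1 := by rw [Complex.normSq_eq_norm_sq, hn]; norm_num
    have h2 : Complex.normSq (1-z) ≠ 0 := by simpa using hz''
    rw [Complex.div_re]
    field_simp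
    rw [Complex.normSq_apply] at *
    simp at *
    nlinarith
  have hmeas : ∀ n, AEStronglyMeasurable (F n) ν := by
    intro n
    apply Continuous.aestronglyMeasurable
    have := (P n).continuous
    simp only [F]
    fun_prop
  have hfin : IsFiniteMeasure ν := by
    constructor; simp [ν]; exact ENNReal.mul_lt_top (by simp) (by simp)
  have htm := tendstoInMeasure_of_tendsto_ae hmeas hlim
  have h4 := htm (1/4) (by simp)
  have h5 := (h4.eventually (gt_mem_nhds (show (0:ENNReal) < ENNReal.ofReal δ by simpa using hδ))).exists
  obtain ⟨n, hn⟩ := h5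
  refine ⟨P n, hP0 n, le_trans ?_ hn.le⟩
  rw [Measure.restrict_apply₀']
  · have : volume {x ∈ Ioc (0:ℝ) (2*π) | ¬ (((P n).eval (Complex.exp (Complex.I * x))).re ≤ -(1/4))} ≤
      volume (({x | (1/4:ENNReal) ≤ edist (F n x) (g x)} ∩ Ioo 0 (2*π)) ∪ {2*π}) := by
      apply measure_mono
      rintro x ⟨hx, hx2⟩
      by_cases h : x = 2*π
      · right; exact h
      left
      have hx' : x ∈ Ioo (0:ℝ) (2*π) := ⟨hx.1, lt_of_le_of_ne hx.2 h⟩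
      refine ⟨?_, hx'⟩
      simp only [mem_ofPred_eq]
      rw [edist_dist, dist_eq_norm]
      have h7 : (1/4:ENNReal) = ENNReal.ofReal (1/4) := by
        rw [ENNReal.ofReal_div_of_pos (by norm_num)]; simp
      rw [h7]
      apply ENNReal.ofReal_le_ofReal
      have h8 := Complex.re_le_norm (F n x - g x)
      rw [Complex.sub_re, hre x hx'] at h8
      push Not at hx2
      have : (F n x).re = ((P n).eval (Complex.exp (Complex.I * x))).re := rfl
      linarith
    refine this.trans ((measure_union_le _ _).trans ?_)
    simp
  · exact measurableSet_Ioo.nullMeasurableSet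

lemma exists_h (η δ : ℝ) (hη : 0 < η) (hδ : 0 < δ) : ∃ h : Polynomial ℂ, h.coeff 0 = 1 ∧
    volume {x ∈ Ioc (0:ℝ) (2*π) | η < ‖h.eval (Complex.exp (Complex.I * x))‖} ≤ ENNReal.ofReal δ := by
  obtain ⟨p, hp0, hp⟩ := exists_p δ hδ
  obtain ⟨S, hS⟩ : ∃ S : ℝ, ∀ z : ℂ, ‖z‖ = 1 → ‖p.eval z‖ ≤ S := by
    obtain ⟨S, hS⟩ := (isCompact_sphere (0:ℂ) 1).exists_bound_of_continuousOn (f := fun z => p.eval z) p.continuous.continuousOn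
    exact ⟨S, fun z hz => hS z (by simpa using hz)⟩
  have hnorm : ∀ x : ℝ, ‖Complex.exp (Complex.I * x)‖ = 1 := by
    intro x
    rw [mul_comm]; exact Complex.norm_exp_ofReal_mul_I x
  set ρ : ℝ := 1/(4*(S^2+1)) with hρ
  have hρ0 : 0 < ρ := by positivity
  have hρ1 : ρ * (4*(S^2+1)) = 1 := by rw [hρ]; field_simp
  have hρ2 : ρ ≤ 1/4 := by nlinarith [sq_nonneg S]
  obtain ⟨M, hM⟩ := exists_pow_lt_of_lt_one (show 0 < η^2 by positivity) (show 1 - ρ/4 < 1 by linarith)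
  refine ⟨(1 + Polynomial.C (ρ:ℂ) * p)^M, ?_, le_trans (measure_mono ?_) hp⟩
  · rw [Polynomial.coeff_zero_eq_eval_zero] at hp0 ⊢
    simp [hp0]
  · rintro x ⟨hx, hx2⟩
    refine ⟨hx, fun hcon => ?_⟩
    have hb := hS _ (hnorm x)
    simp only [Polynomial.eval_pow, Polynomial.eval_add, Polynomial.eval_one, Polynomial.eval_mul, Polynomial.eval_C, norm_pow] at hx2
    set w := p.eval (Complex.exp (Complex.I * x)) with hw
    have h1 : ‖1 + (ρ:ℂ) * w‖^2 ≤ 1 - ρ/4 := by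
      rw [← Complex.normSq_eq_norm_sq, Complex.normSq_apply]
      have h2 : ‖w‖^2 = w.re*w.re+w.im*w.im := by rw [← Complex.normSq_eq_norm_sq, Complex.normSq_apply]
      have h3 : ‖w‖^2 ≤ S^2 := by
        have := norm_nonneg w
        nlinarith
      simp
      have h4 : ρ * (ρ * S^2) ≤ ρ * (1/4) := by
        apply mul_le_mul_of_nonneg_left _ hρ0.le
        nlinarith
      have h5 : ρ * (ρ * (w.re*w.re+w.im*w.im)) ≤ ρ * (ρ * S^2) := by
        gcongr; linarith
      nlinarith
    have h6 : (‖1 + (ρ:ℂ) * w‖^M)^2 ≤ (1-ρ/4)^M := by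
      rw [← pow_mul, mul_comm M 2, pow_mul]
      gcongr
    have h7 : η^2 < (‖1 + (ρ:ℂ) * w‖^M)^2 := by gcongr
    linarith


noncomputable abbrev ex (k : ℤ) (x : ℝ) : ℂ := Complex.exp (Complex.I * (k:ℂ) * (x:ℂ))

lemma ex_norm (k : ℤ) (x : ℝ) : ‖ex k x‖ = 1 := by
  have : Complex.I * (k:ℂ) * (x:ℂ) = ((k * x : ℝ) : ℂ) * Complex.I := by push_cast; ring
  rw [ex, this]; exact Complex.norm_exp_ofReal_mul_I _

lemma ex_add (j k : ℤ) (x : ℝ) : ex (j + k) x = ex j x * ex k x := by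
  rw [ex, ex, ex, ← Complex.exp_add]; push_cast; congr 1; ring

lemma ex_cont (k : ℤ) : Continuous (ex k) := by
  unfold ex; fun_prop

lemma fourier_ex (k : ℤ) (x : ℝ) : (fourier k : C(AddCircle (2*π), ℂ)) (x : AddCircle (2*π)) = ex k x := by
  rw [fourier_coe_apply, ex]
  congr 1
  have : (π:ℂ) ≠ 0 := by exact_mod_cast Real.pi_ne_zero
  push_cast
  field_simp

lemma bridge (F : AddCircle (2*π) → ENNReal) [Fact (0 < 2*π)] :
    ∫⁻ x in Ioc (0:ℝ) (2*π), F (x : AddCircle (2*π)) = ENNReal.ofReal (2*π) * ∫⁻ y, F y ∂AddCircle.haarAddCircle := by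
  have h := AddCircle.lintegral_preimage (2*π) 0 F
  rw [zero_add] at h
  rw [h, AddCircle.volume_eq_smul_haarAddCircle, lintegral_smul_measure, smul_eq_mul]

lemma trig_L1 (S : Finset ℤ) (c : ℤ → ℂ) :
    ∫⁻ x in Ioc (0:ℝ) (2*π), ‖∑ k ∈ S, c k * ex k x‖ₑ ≤ ENNReal.ofReal (2*π*√(∑ k ∈ S, ‖c k‖^2)) := by
  have : Fact (0 < 2*π) := ⟨by positivity⟩
  let f : C(AddCircle (2*π), ℂ) := ∑ k ∈ S, c k • fourier k
  have hf : ∀ x : ℝ, f (x : AddCircle (2*π)) = ∑ k ∈ S, c k * ex k x := by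
    intro x
    simp only [f, ContinuousMap.coe_sum, ContinuousMap.coe_smul, Finset.sum_apply, Pi.smul_apply, smul_eq_mul, fourier_ex]
  simp_rw [← hf]
  rw [bridge (fun y => ‖f y‖ₑ), ENNReal.ofReal_mul (p := 2*π) (by positivity)]
  gcongr
  rw [← eLpNorm_one_eq_lintegral_enorm]
  refine (eLpNorm_le_eLpNorm_of_exponent_le (q := 2) (by norm_num) f.continuous.aestronglyMeasurable).trans ?_
  have h1 : eLpNorm f 2 AddCircle.haarAddCircle = ‖ContinuousMap.toLp (E := ℂ) 2 AddCircle.haarAddCircle ℂ f‖ₑ := by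
    rw [Lp.enorm_def]
    exact (eLpNorm_congr_ae (ContinuousMap.coeFn_toLp _ f)).symm
  rw [h1, ← ofReal_norm]
  apply ENNReal.ofReal_le_ofReal
  have h2 : ContinuousMap.toLp (E := ℂ) 2 AddCircle.haarAddCircle ℂ f = ∑ k ∈ S, c k • (fourierLp 2 k : Lp ℂ 2 (AddCircle.haarAddCircle (T := 2*π))) := by
    simp only [f, map_sum, map_smul]
  rw [h2]
  apply Real.le_sqrt_of_sq_le
  have h3 := (orthonormal_fourier (T := 2*π)).inner_sum c c S
  have h4 := inner_self_eq_norm_sq_to_K (𝕜 := ℂ) (∑ k ∈ S, c k • (fourierLp 2 k : Lp ℂ 2 (AddCircle.haarAddCircle (T := 2*π))))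
  rw [h4] at h3
  apply le_of_eq
  have h5 : ∀ k, (starRingEnd ℂ) (c k) * c k = ((‖c k‖^2 : ℝ) : ℂ) := by
    intro k
    rw [mul_comm, Complex.mul_conj, Complex.normSq_eq_norm_sq]
  simp only [h5] at h3
  have h6 : (Complex.ofReal ‖∑ k ∈ S, c k • (fourierLp 2 k : Lp ℂ 2 (AddCircle.haarAddCircle (T := 2*π)))‖)^2 = ∑ k ∈ S, ((‖c k‖^2 : ℝ) : ℂ) := h3
  exact_mod_cast h6

lemma int_bound (φ : ℝ → ℂ) (G s : ℝ) (hG : 0 ≤ G) (hs : 0 ≤ s) (I : Set ℝ) (hI : MeasurableSet I)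
    (hφG : ∀ x, ‖φ x‖ ≤ G) (hφI : ∀ x ∉ I, φ x = 0)
    (hIs : volume (I ∩ Ioc 0 (2*π)) ≤ ENNReal.ofReal (2*π*s)) (m : ℕ) (hm : m ≠ 0) :
    (2*π)⁻¹ * ∫ x in Ioc (0:ℝ) (2*π), ‖φ x‖^m ≤ G^m * s := by
  have h1 : ∫ x in Ioc (0:ℝ) (2*π), ‖φ x‖^m ≤ ∫ x in Ioc (0:ℝ) (2*π), I.indicator (fun _ => G^m) x := by
    apply integral_mono_of_nonneg
    · exact ae_of_all _ fun x => by positivity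
    · apply Integrable.indicator _ hI
      exact integrable_const _
    · refine ae_of_all _ fun x => ?_
      by_cases hx : x ∈ I
      · simp only [indicator_of_mem hx]
        exact pow_le_pow_left₀ (norm_nonneg _) (hφG x) m
      · simp [indicator_of_notMem hx, hφI x hx, hm]
  have h2 : ∫ x in Ioc (0:ℝ) (2*π), I.indicator (fun _ => G^m) x ≤ G^m * (2*π*s) := by
    rw [integral_indicator hI, Measure.restrict_restrict hI, setIntegral_const, smul_eq_mul, mul_comm]
    gcongr
    rw [measureReal_def]
    exact ENNReal.toReal_le_of_le_ofReal (by positivity) hIs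
  calc (2*π)⁻¹ * ∫ x in Ioc (0:ℝ) (2*π), ‖φ x‖^m ≤ (2*π)⁻¹ * (G^m * (2*π*s)) := by
        gcongr; exact h1.trans h2
    _ = G^m*s := by
        have := Real.pi_ne_zero
        field_simp

lemma fourier_approx (φ : ℝ → ℂ) (hφ : Measurable φ) (G s : ℝ) (hG : 0 ≤ G) (hs : 0 ≤ s) (I : Set ℝ) (hI : MeasurableSet I)
    (hφG : ∀ x, ‖φ x‖ ≤ G) (hφI : ∀ x ∉ I, φ x = 0)
    (hIs : volume (I ∩ Ioc 0 (2*π)) ≤ ENNReal.ofReal (2*π*s)) (δ : ℝ) (hδ : 0 < δ) :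
    ∃ (d : ℕ) (p : ℤ → ℂ), (∀ j, ‖p j‖ ≤ G * s) ∧ (∀ j, j ∉ Finset.Icc (-d:ℤ) d → p j = 0) ∧
      ∑ j ∈ Finset.Icc (-d:ℤ) d, ‖p j‖^2 ≤ G^2 * s ∧
      ∫⁻ x in Ioc (0:ℝ) (2*π), ‖∑ j ∈ Finset.Icc (-d:ℤ) d, p j * ex j x - φ x‖ₑ ≤ ENNReal.ofReal δ := by
  have : Fact (0 < 2*π) := ⟨by positivity⟩
  let Φ : AddCircle (2*π) → ℂ := AddCircle.liftIoc (2*π) 0 φ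
  have hΦ : ∀ x ∈ Ioc (0:ℝ) (2*π), Φ x = φ x := by
    intro x hx
    exact AddCircle.liftIoc_coe_apply (by simpa using hx)
  have hΦm : Measurable Φ :=
    (hφ.comp measurable_subtype_coe).comp (AddCircle.measurableEquivIoc (2*π) 0).measurable
  have hΦG : ∀ y, ‖Φ y‖ ≤ G := fun y => hφG _
  have hΦ2 : MemLp Φ 2 AddCircle.haarAddCircle :=
    MemLp.of_bound hΦm.aestronglyMeasurable G (ae_of_all _ hΦG)
  have hint : ∀ m : ℕ, m ≠ 0 → ∫ y, ‖Φ y‖^m ∂AddCircle.haarAddCircle ≤ G^m*s := by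
    intro m hm
    rw [AddCircle.integral_haarAddCircle, ← AddCircle.integral_preimage (2*π) 0, zero_add, smul_eq_mul]
    refine le_trans (le_of_eq ?_) (int_bound φ G s hG hs I hI hφG hφI hIs m hm)
    congr 1
    exact setIntegral_congr_fun measurableSet_Ioc fun x hx => by simp only [hΦ x hx]
  let fL := hΦ2.toLp Φ
  have hfL : fL =ᵐ[AddCircle.haarAddCircle] Φ := hΦ2.coeFn_toLp
  let a : ℤ → ℂ := fourierCoeff fL
  have ha : ∀ j, a j = fourierCoeff Φ j := fun j => by simp only [a]; rw [fourierCoeff_congr_ae hfL]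
  have ha1 : ∀ j, ‖a j‖ ≤ G*s := by
    intro j
    rw [ha]
    refine (norm_integral_le_integral_norm _).trans ?_
    have := hint 1 one_ne_zero
    simp only [pow_one] at this
    refine le_trans (le_of_eq ?_) this
    congr 1
    funext t
    rw [norm_smul]
    rw [fourier_apply, Circle.norm_coe, one_mul]
  have hP := hasSum_sq_fourierCoeff fL
  have hP2 : ∫ t : AddCircle (2*π), ‖fL t‖ ^ 2 ∂AddCircle.haarAddCircle ≤ G^2*s := by
    refine le_trans (le_of_eq ?_) (hint 2 two_ne_zero)
    apply integral_congr_ae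
    filter_upwards [hfL] with t ht
    rw [ht]
  have hS := hasSum_fourier_series_L2 fL
  have hδ' : 0 < δ/(2*π) := by positivity
  have hev := Metric.tendsto_atTop.1 hS (δ/(2*π)) hδ'
  obtain ⟨s0, hs0⟩ := hev
  obtain ⟨d, hd⟩ : ∃ d : ℕ, s0 ⊆ Finset.Icc (-d:ℤ) d := by
    refine ⟨s0.sup Int.natAbs, fun j hj => ?_⟩
    have := Finset.le_sup (f := Int.natAbs) hj
    rw [Finset.mem_Icc]; omega
  refine ⟨d, fun j => if j ∈ Finset.Icc (-d:ℤ) d then a j else 0, ?_, ?_, ?_, ?_⟩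
  · intro j
    dsimp only
    split_ifs
    · exact ha1 j
    · simp; positivity
  · intro j hj
    simp only [if_neg hj]
  · rw [Finset.sum_congr rfl (g := fun j => ‖a j‖^2) (fun j hj => by simp only [if_pos hj])]
    exact (sum_le_hasSum _ (fun _ _ => by positivity) hP).trans hP2
  · have h1 := hs0 _ hd
    let f : C(AddCircle (2*π), ℂ) := ∑ k ∈ Finset.Icc (-d:ℤ) d, a k • fourier k
    have hf : ∀ x : ℝ, f (x : AddCircle (2*π)) = ∑ k ∈ Finset.Icc (-d:ℤ) d, a k * ex k x := by
      intro x
      simp only [f, ContinuousMap.coe_sum, ContinuousMap.coe_smul, Finset.sum_apply, Pi.smul_apply, smul_eq_mul, fourier_ex]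
    have h2 : ContinuousMap.toLp (E := ℂ) 2 AddCircle.haarAddCircle ℂ f = ∑ k ∈ Finset.Icc (-d:ℤ) d, a k • (fourierLp 2 k : Lp ℂ 2 (AddCircle.haarAddCircle (T := 2*π))) := by
      simp only [f, map_sum, map_smul]
    have h1' : dist (ContinuousMap.toLp (E := ℂ) 2 AddCircle.haarAddCircle ℂ f) fL < δ/(2*π) := by
      rw [h2]; exact h1
    have h3 : ∫⁻ x in Ioc (0:ℝ) (2*π), ‖∑ j ∈ Finset.Icc (-d:ℤ) d, (if j ∈ Finset.Icc (-d:ℤ) d then a j else 0) * ex j x - φ x‖ₑ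
        = ∫⁻ x in Ioc (0:ℝ) (2*π), ‖f (x : AddCircle (2*π)) - Φ (x : AddCircle (2*π))‖ₑ := by
      refine setLIntegral_congr_fun measurableSet_Ioc fun x hx => ?_
      simp only [hf, hΦ x hx]
      rw [Finset.sum_congr rfl (fun j hj => by rw [if_pos hj])]
    rw [h3, bridge (fun y => ‖f y - Φ y‖ₑ), ← eLpNorm_one_eq_lintegral_enorm (f := fun y => f y - Φ y)]
    have h4 : eLpNorm (fun y => f y - Φ y) 1 AddCircle.haarAddCircle ≤ ENNReal.ofReal (δ/(2*π)) := by
      refine (eLpNorm_le_eLpNorm_of_exponent_le (q := 2) (by norm_num)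
        (f.continuous.aestronglyMeasurable.sub hΦm.aestronglyMeasurable)).trans ?_
      rw [dist_eq_norm] at h1'
      refine le_trans (le_of_eq ?_) (ENNReal.ofReal_le_ofReal h1'.le)
      rw [ofReal_norm, Lp.enorm_def]
      apply eLpNorm_congr_ae
      filter_upwards [ContinuousMap.coeFn_toLp (E := ℂ) (p := 2) (𝕜 := ℂ) AddCircle.haarAddCircle f, hfL,
        Lp.coeFn_sub (ContinuousMap.toLp (E := ℂ) 2 AddCircle.haarAddCircle ℂ f) fL] with t h5 h6 h7
      rw [h7]
      exact congrArg₂ (fun u v : ℂ => u - v) h5.symm h6.symm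
    calc _ ≤ ENNReal.ofReal (2*π) * ENNReal.ofReal (δ/(2*π)) := by gcongr
      _ = ENNReal.ofReal δ := by
        rw [← ENNReal.ofReal_mul (by positivity)]
        congr 1
        field_simp


lemma bad_measure (Θ : Set ℝ) (hΘ : MeasurableSet Θ) (hper : ∀ x, x + 2*π ∈ Θ ↔ x ∈ Θ) (b : ℝ) (hb : 0 ≤ b)
    (hΘb : volume (Ioc (0:ℝ) (2*π) ∩ Θ) ≤ ENNReal.ofReal b) (J M i : ℕ) (hJ : 0 < J) (hM : 0 < M) :
    volume (Ioc (2*π*(i/J)) (2*π*((i+1)/J)) ∩ {x | (J*M:ℝ) * x ∈ Θ}) ≤ ENNReal.ofReal (b/J) := by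
  have hJ' : (0:ℝ) < J := by exact_mod_cast hJ
  have hM' : (0:ℝ) < M := by exact_mod_cast hM
  let f : ℝ → ℝ := Θ.indicator (fun _ => 1)
  have hf : Function.Periodic f (2*π) := by
    intro x
    by_cases hx : x ∈ Θ
    · simp only [f]
      rw [indicator_of_mem hx, indicator_of_mem ((hper x).2 hx)]
    · simp only [f]
      rw [indicator_of_notMem hx, indicator_of_notMem (mt (hper x).1 hx)]
  have hfi : ∀ t₁ t₂, IntervalIntegrable f volume t₁ t₂ := by
    intro t₁ t₂
    rw [intervalIntegrable_iff]
    exact (integrableOn_const (by simp)).indicator hΘ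
  have hΘ' : MeasurableSet {x : ℝ | (J*M:ℝ) * x ∈ Θ} := by
    have : Measurable (fun x : ℝ => (J*M:ℝ) * x) := by fun_prop
    exact this hΘ
  have hle : 2*π*((i:ℝ)/J) ≤ 2*π*((i+1)/J) := by gcongr; linarith
  have h1 : ∫ x in (2*π*(i/J))..(2*π*((i+1)/J)), f ((J*M:ℝ)*x) =
      volume.real (Ioc (2*π*(i/J)) (2*π*((i+1)/J)) ∩ {x | (J*M:ℝ) * x ∈ Θ}) := by
    rw [intervalIntegral.integral_of_le hle]
    have : (fun x => f ((J*M:ℝ)*x)) = {x : ℝ | (J*M:ℝ) * x ∈ Θ}.indicator (fun _ => 1) := by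
      funext x; rfl
    rw [this, integral_indicator hΘ', Measure.restrict_restrict hΘ', setIntegral_const, inter_comm]
    simp
  have h2 : ∫ x in (0:ℝ)..(2*π), f x ≤ b := by
    rw [intervalIntegral.integral_of_le (by positivity), integral_indicator hΘ, Measure.restrict_restrict hΘ, setIntegral_const, inter_comm]
    simp only [smul_eq_mul, mul_one, measureReal_def]
    exact ENNReal.toReal_le_of_le_ofReal hb hΘb
  have h3 : ∫ x in (2*π*(i/J))..(2*π*((i+1)/J)), f ((J*M:ℝ)*x) = (1/J) * ∫ x in (0:ℝ)..(2*π), f x := by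
    rw [intervalIntegral.integral_comp_mul_left f (by positivity : (J*M:ℝ) ≠ 0)]
    have e1 : (J*M:ℝ) * (2*π*(i/J)) = 2*π*i*M := by field_simp
    have e2 : (J*M:ℝ) * (2*π*((i+1)/J)) = 2*π*i*M + (M:ℤ) • (2*π) := by
      simp only [zsmul_eq_mul, Int.cast_natCast]; field_simp
    rw [e1, e2, hf.intervalIntegral_add_zsmul_eq _ _ hfi, hf.intervalIntegral_add_eq _ 0, zero_add]
    simp only [zsmul_eq_mul, Int.cast_natCast, smul_eq_mul]
    field_simp
  rw [ENNReal.le_ofReal_iff_toReal_le _ (by positivity)]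
  · change volume.real _ ≤ _
    rw [← h1, h3]
    have h4 := mul_le_mul_of_nonneg_left h2 (by positivity : (0:ℝ) ≤ 1/J)
    have h5 : b / J = 1/J*b := by ring
    rw [h5]; exact h4
  · exact ne_top_of_le_ne_top (by simp) (measure_mono inter_subset_left)

lemma shift_sum {E : Type*} [AddCommMonoid E] (q : ℤ → E) (d : ℕ) (hq : ∀ j, j ∉ Finset.Icc (-d:ℤ) d → q j = 0)
    (N N' s : ℤ) (h1 : N ≤ s - d) (h2 : s + d < N') :
    ∑ m ∈ Finset.Ico N N', q (m - s) = ∑ j ∈ Finset.Icc (-d:ℤ) d, q j := by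
  have hsub : (Finset.Icc (-d:ℤ) d).image (· + s) ⊆ Finset.Ico N N' := by
    intro m hm
    simp only [Finset.mem_image, Finset.mem_Icc, Finset.mem_Ico] at hm ⊢
    obtain ⟨j, hj, rfl⟩ := hm
    omega
  rw [← Finset.sum_subset hsub, Finset.sum_image]
  · simp
  · intro a _ b _ h
    simpa using h
  · intro m _ hm
    apply hq
    intro hj
    exact hm (Finset.mem_image.2 ⟨m - s, hj, by ring⟩)

lemma piece (g : ℝ → ℂ) (hg : Measurable g) (G : ℝ) (hG : 0 ≤ G) (hgG : ∀ x, ‖g x‖ ≤ G)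
    (h : Polynomial ℂ) (h0 : h.coeff 0 = 1) (η b A : ℝ) (hη : 0 < η) (hb : 0 ≤ b)
    (hbad : volume {x ∈ Ioc (0:ℝ) (2*π) | η < ‖h.eval (Complex.exp (Complex.I * x))‖} ≤ ENNReal.ofReal b)
    (hA : ∑ k ∈ Finset.range h.natDegree, ‖h.coeff (k+1)‖ ≤ A) (hA0 : 0 ≤ A)
    (J i : ℕ) (hi : i < J) (N : ℤ) (δ : ℝ) (hδ : 0 < δ) :
    ∃ (N' : ℤ) (c : ℤ → ℂ) (B : Set ℝ), N < N' ∧ MeasurableSet B ∧ volume B ≤ ENNReal.ofReal (b/J) ∧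
      (∀ k, ‖c k‖ ≤ A*(G/J)) ∧ ∑ k ∈ Finset.Ico N N', ‖c k‖^2 ≤ A^2*(G^2/J) ∧
      ∫⁻ x in Ioc (0:ℝ) (2*π) \ B, ‖∑ k ∈ Finset.Ico N N', c k * ex k x -
        (Ioc (2*π*(i/J)) (2*π*((i+1)/J))).indicator g x‖ₑ ≤ ENNReal.ofReal (A*δ + η*G*(2*π/J)) := by
  have hJ : 0 < J := by omega
  have hJ' : (0:ℝ) < J := by exact_mod_cast hJ
  set I : Set ℝ := Ioc (2*π*(i/J)) (2*π*((i+1)/J)) with hIdef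
  have hI : MeasurableSet I := measurableSet_Ioc
  have hvI : volume I = ENNReal.ofReal (2*π*(1/J)) := by
    rw [hIdef, Real.volume_Ioc]; congr 1; field_simp; ring
  set φ := I.indicator g with hφdef
  have hφm : Measurable φ := hg.indicator hI
  have hφG : ∀ x, ‖φ x‖ ≤ G := fun x => (norm_indicator_le_norm_self _ _).trans (hgG x)
  obtain ⟨d, p, hp1, hp0, hp2, hpφ⟩ := fourier_approx φ hφm G (1/J) hG (by positivity) I hI hφG
    (fun x hx => indicator_of_notMem hx _) ((measure_mono inter_subset_left).trans hvI.le) δ hδ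
  let K := h.natDegree
  let a : ℕ → ℂ := fun k => h.coeff (k+1)
  have heval : ∀ z : ℂ, h.eval z = 1 + ∑ k ∈ Finset.range K, a k * z^(k+1) := by
    intro z
    rw [Polynomial.eval_eq_sum_range, Finset.sum_range_succ', h0]
    simp [add_comm, a, K]
  let M : ℕ := N.natAbs + d + 1
  let n : ℤ := J * M
  have hnM : (M:ℤ) ≤ n := by
    have : (1:ℤ) ≤ J := by exact_mod_cast hJ
    simp only [n]; nlinarith [Int.natCast_nonneg M]
  have hnN : N + d < n := by
    have : N + d < M := by simp only [M]; omega
    omega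
  have hnpos : 0 < n := by
    have : 0 < (M:ℤ) := by simp only [M]; positivity
    omega
  let c : ℤ → ℂ := fun m => - ∑ k ∈ Finset.range K, a k * p (m - n*(k+1))
  let N' : ℤ := n * (K+1) + d + 1
  have hs : ∀ k ∈ Finset.range K, N ≤ n*((k:ℤ)+1) - d ∧ n*((k:ℤ)+1) + d < N' := by
    intro k hk
    rw [Finset.mem_range] at hk
    have hk' : (k:ℤ) + 1 ≤ K := by exact_mod_cast hk
    have hk0 : (0:ℤ) ≤ k := by positivity
    constructor
    · nlinarith
    · simp only [N']; nlinarith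
  let Θ : Set ℝ := {x | η < ‖h.eval (Complex.exp (Complex.I * x))‖}
  have hΘ : MeasurableSet Θ := by
    apply measurableSet_lt measurable_const
    have : Continuous (fun x : ℝ => ‖h.eval (Complex.exp (Complex.I * x))‖) := by
      have := h.continuous
      fun_prop
    exact this.measurable
  have hper : ∀ x, x + 2*π ∈ Θ ↔ x ∈ Θ := by
    intro x
    have : Complex.exp (Complex.I * ((x + 2*π : ℝ):ℂ)) = Complex.exp (Complex.I * x) := by
      push_cast
      rw [mul_add, Complex.exp_add, show Complex.I * (2*π) = 2*π*Complex.I by ring, Complex.exp_two_pi_mul_I, mul_one]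
    simp only [Θ, mem_ofPred_eq, this]
  let B : Set ℝ := I ∩ {x | (J*M:ℝ) * x ∈ Θ}
  have hBm : MeasurableSet B := by
    have : Measurable (fun x : ℝ => (J*M:ℝ) * x) := by fun_prop
    exact hI.inter (this hΘ)
  have hM0 : 0 < M := by simp [M]
  have hvB : volume B ≤ ENNReal.ofReal (b/J) :=
    bad_measure Θ hΘ hper b hb hbad J M i hJ hM0
  refine ⟨N', c, B, ?_, hBm, hvB, ?_, ?_, ?_⟩
  · simp only [N']
    have : (0:ℤ) ≤ K := by positivity
    nlinarith
  · intro m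
    simp only [c, norm_neg]
    calc _ ≤ ∑ k ∈ Finset.range K, ‖a k * p (m - n*(k+1))‖ := norm_sum_le _ _
      _ ≤ ∑ k ∈ Finset.range K, ‖a k‖ * (G * (1/J)) := by
        gcongr with k hk
        rw [norm_mul]; gcongr; exact hp1 _
      _ = (∑ k ∈ Finset.range K, ‖a k‖) * (G/J) := by rw [← Finset.sum_mul]; ring
      _ ≤ A * (G/J) := by gcongr
  · have h1 : ∀ m, ‖c m‖^2 ≤ A * ∑ k ∈ Finset.range K, ‖a k‖ * ‖p (m - n*(k+1))‖^2 := by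
      intro m
      have h2 : ‖c m‖ ≤ ∑ k ∈ Finset.range K, ‖a k‖ * ‖p (m - n*(k+1))‖ := by
        simp only [c, norm_neg]
        refine (norm_sum_le _ _).trans (le_of_eq ?_)
        simp only [norm_mul]
      calc ‖c m‖^2 ≤ (∑ k ∈ Finset.range K, ‖a k‖ * ‖p (m - n*(k+1))‖)^2 := by gcongr
        _ ≤ (∑ k ∈ Finset.range K, ‖a k‖) * ∑ k ∈ Finset.range K, ‖a k‖ * ‖p (m - n*(k+1))‖^2 := by
          apply Finset.sum_sq_le_sum_mul_sum_of_sq_le_mul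
          · intros; positivity
          · intros; positivity
          · intros; apply le_of_eq; ring
        _ ≤ _ := by gcongr
    calc ∑ m ∈ Finset.Ico N N', ‖c m‖^2 ≤ ∑ m ∈ Finset.Ico N N', A * ∑ k ∈ Finset.range K, ‖a k‖ * ‖p (m - n*(k+1))‖^2 :=
          Finset.sum_le_sum fun m _ => h1 m
      _ = A * ∑ k ∈ Finset.range K, ‖a k‖ * ∑ m ∈ Finset.Ico N N', ‖p (m - n*(k+1))‖^2 := by
          rw [← Finset.mul_sum, Finset.sum_comm]
          simp only [Finset.mul_sum]
      _ = A * ∑ k ∈ Finset.range K, ‖a k‖ * ∑ j ∈ Finset.Icc (-d:ℤ) d, ‖p j‖^2 := by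
          congr 1
          refine Finset.sum_congr rfl fun k hk => ?_
          congr 1
          exact shift_sum (fun j => ‖p j‖^2) d (fun j hj => by simp [hp0 j hj]) N N' _ (hs k hk).1 (hs k hk).2
      _ = A * ((∑ k ∈ Finset.range K, ‖a k‖) * ∑ j ∈ Finset.Icc (-d:ℤ) d, ‖p j‖^2) := by rw [Finset.sum_mul]
      _ ≤ A * (A * (G^2*(1/J))) := by gcongr
      _ = _ := by ring
  · let P : ℝ → ℂ := fun x => ∑ j ∈ Finset.Icc (-d:ℤ) d, p j * ex j x
    have hPm : Measurable P := by
      have : Continuous P := by simp only [P]; unfold ex; fun_prop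
      exact this.measurable
    let Z : ℝ → ℂ := fun x => Complex.exp (Complex.I * (((J*M:ℝ)*x : ℝ):ℂ))
    have hZ : ∀ x (k : ℕ), ex (n*(k+1)) x = Z x^(k+1) := by
      intro x k
      simp only [ex, Z, n, ← Complex.exp_nat_mul]
      congr 1
      push_cast; ring
    have hZn : ∀ x, ‖Z x‖ = 1 := by
      intro x; simp only [Z]; rw [mul_comm]; exact Complex.norm_exp_ofReal_mul_I _
    have hT : ∀ x, ∑ m ∈ Finset.Ico N N', c m * ex m x = P x * (1 - h.eval (Z x)) := by
      intro x
      calc ∑ m ∈ Finset.Ico N N', c m * ex m x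
          = - ∑ k ∈ Finset.range K, a k * ∑ m ∈ Finset.Ico N N', p (m - n*(k+1)) * ex ((m - n*(k+1)) + n*(k+1)) x := by
            simp only [c, neg_mul, Finset.sum_neg_distrib, Finset.sum_mul, sub_add_cancel]
            rw [Finset.sum_comm]
            simp only [Finset.mul_sum, mul_assoc]
        _ = - ∑ k ∈ Finset.range K, a k * (Z x^(k+1) * P x) := by
            congr 1
            refine Finset.sum_congr rfl fun k hk => ?_
            congr 1
            rw [shift_sum (fun j => p j * ex (j + n*(k+1)) x) d (fun j hj => by simp [hp0 j hj]) N N' _ (hs k hk).1 (hs k hk).2]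
            simp only [P, Finset.mul_sum]
            refine Finset.sum_congr rfl fun j _ => ?_
            rw [ex_add, hZ]; ring
        _ = _ := by
            rw [heval]
            simp only [← mul_assoc, ← Finset.sum_mul]
            ring
    have h1h : ∀ x, ‖1 - h.eval (Z x)‖ ≤ A := by
      intro x
      rw [heval]
      have : 1 - (1 + ∑ k ∈ Finset.range K, a k * Z x^(k+1)) = - ∑ k ∈ Finset.range K, a k * Z x^(k+1) := by ring
      rw [this, norm_neg]
      refine (norm_sum_le _ _).trans (le_trans (le_of_eq ?_) hA)
      refine Finset.sum_congr rfl fun k _ => ?_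
      rw [norm_mul, norm_pow, hZn]; simp [a]
    have hpt : ∀ x ∈ Ioc (0:ℝ) (2*π) \ B, ‖∑ k ∈ Finset.Ico N N', c k * ex k x - φ x‖ₑ ≤
        ENNReal.ofReal A * ‖P x - φ x‖ₑ + I.indicator (fun _ => ENNReal.ofReal (η*G)) x := by
      intro x hx
      rw [hT]
      have e : P x * (1 - h.eval (Z x)) - φ x = (P x - φ x) * (1 - h.eval (Z x)) - φ x * h.eval (Z x) := by ring
      rw [e]
      refine (enorm_sub_le).trans ?_
      gcongr
      · rw [enorm_mul, mul_comm]
        gcongr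
        rw [← ofReal_norm]
        exact ENNReal.ofReal_le_ofReal (h1h x)
      · by_cases hxI : x ∈ I
        · rw [indicator_of_mem hxI, ← ofReal_norm]
          apply ENNReal.ofReal_le_ofReal
          rw [norm_mul, mul_comm]
          have hxB : ¬ ((J*M:ℝ) * x ∈ Θ) := fun hc => hx.2 ⟨hxI, hc⟩
          simp only [Θ, mem_ofPred_eq, not_lt] at hxB
          have : ‖h.eval (Z x)‖ ≤ η := by simpa only [Z] using hxB
          gcongr
          exact hφG x
        · simp [hφdef, indicator_of_notMem hxI]
    have hsub : Ioc (0:ℝ) (2*π) \ B ⊆ Ioc (0:ℝ) (2*π) := Set.sdiff_subset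
    calc _ ≤ ∫⁻ x in Ioc (0:ℝ) (2*π) \ B, (ENNReal.ofReal A * ‖P x - φ x‖ₑ + I.indicator (fun _ => ENNReal.ofReal (η*G)) x) :=
          setLIntegral_mono' (measurableSet_Ioc.diff hBm) hpt
      _ ≤ ∫⁻ x in Ioc (0:ℝ) (2*π), (ENNReal.ofReal A * ‖P x - φ x‖ₑ + I.indicator (fun _ => ENNReal.ofReal (η*G)) x) :=
          lintegral_mono_set hsub
      _ = ENNReal.ofReal A * (∫⁻ x in Ioc (0:ℝ) (2*π), ‖P x - φ x‖ₑ) + ∫⁻ x in Ioc (0:ℝ) (2*π), I.indicator (fun _ => ENNReal.ofReal (η*G)) x := by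
          rw [lintegral_add_right _ (measurable_const.indicator hI), lintegral_const_mul]
          exact (hPm.sub hφm).enorm
      _ ≤ ENNReal.ofReal A * ENNReal.ofReal δ + ENNReal.ofReal (η*G) * ENNReal.ofReal (2*π*(1/J)) := by
          gcongr
          refine (setLIntegral_le_lintegral _ _).trans ?_
          rw [lintegral_indicator_const hI, hvI]
      _ = _ := by
          rw [← ENNReal.ofReal_mul hA0, ← ENNReal.ofReal_mul (by positivity), ← ENNReal.ofReal_add (by positivity) (by positivity)]
          congr 1
          ring


lemma sum_Ico_split {E : Type*} [AddCommMonoid E] (N M N' : ℤ) (h1 : N ≤ M) (h2 : M ≤ N') (f f2 : ℤ → E) :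
    ∑ k ∈ Finset.Ico N N', (if k < M then f k else f2 k) = ∑ k ∈ Finset.Ico N M, f k + ∑ k ∈ Finset.Ico M N', f2 k := by
  rw [← Finset.Ico_union_Ico_eq_Ico h1 h2, Finset.sum_union (Finset.Ico_disjoint_Ico_consecutive N M N')]
  congr 1
  · refine Finset.sum_congr rfl fun k hk => ?_
    rw [Finset.mem_Ico] at hk
    rw [if_pos hk.2]
  · refine Finset.sum_congr rfl fun k hk => ?_
    rw [Finset.mem_Ico] at hk
    rw [if_neg (by omega)]

lemma block_ind (g : ℝ → ℂ) (hg : Measurable g) (J : ℕ) (hJ : 0 < J) (N : ℤ) (δ u1 u2 u3 u4 u5 : ℝ)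
    (hu1 : 0 ≤ u1) (hu2 : 0 ≤ u2) (hu3 : 0 ≤ u3) (hu4 : 0 ≤ u4)
    (Hp : ∀ i < J, ∀ M : ℤ, ∃ (N' : ℤ) (c : ℤ → ℂ) (B : Set ℝ), M < N' ∧ MeasurableSet B ∧ volume B ≤ ENNReal.ofReal u1 ∧
      (∀ k, ‖c k‖ ≤ 1) ∧ ∑ k ∈ Finset.Ico M N', ‖c k‖^(2+δ) ≤ u2 ∧
      (∀ m ≤ N', ∫⁻ x in Ioc (0:ℝ) (2*π), ‖∑ k ∈ Finset.Ico M m, c k * ex k x‖ₑ ≤ ENNReal.ofReal u3) ∧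
      ∫⁻ x in Ioc (0:ℝ) (2*π) \ B, ‖∑ k ∈ Finset.Ico M N', c k * ex k x -
        (Ioc (2*π*(i/J)) (2*π*((i+1)/J))).indicator g x‖ₑ ≤ ENNReal.ofReal u4) (i : ℕ) (hi : i ≤ J) :
    ∃ (N' : ℤ) (c : ℤ → ℂ) (B : Set ℝ), N + i ≤ N' ∧ MeasurableSet B ∧ volume B ≤ ENNReal.ofReal (i*u1) ∧
      (∀ k, ‖c k‖ ≤ 1) ∧ ∑ k ∈ Finset.Ico N N', ‖c k‖^(2+δ) ≤ i*u2 ∧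
      (∀ m, m ≤ N' → ∃ A, MeasurableSet A ∧ ∫⁻ x in Ioc (0:ℝ) (2*π) \ B, ‖∑ k ∈ Finset.Ico N m, c k * ex k x - A.indicator g x‖ₑ ≤
        ENNReal.ofReal (i*u4 + u3)) ∧
      ∫⁻ x in Ioc (0:ℝ) (2*π) \ B, ‖∑ k ∈ Finset.Ico N N', c k * ex k x -
        (Ioc 0 (2*π*(i/J))).indicator g x‖ₑ ≤ ENNReal.ofReal (i*u4) := by
  have hJ' : (0:ℝ) < J := by exact_mod_cast hJ
  have mcont : ∀ (S : Finset ℤ) (c : ℤ → ℂ), Measurable (fun x : ℝ => ∑ k ∈ S, c k * ex k x) := by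
    intro S c
    have : Continuous (fun x : ℝ => ∑ k ∈ S, c k * ex k x) := by unfold ex; fun_prop
    exact this.measurable
  induction i with
  | zero =>
    refine ⟨N, 0, ∅, by simp, MeasurableSet.empty, by simp, by simp, by simp, ?_, by simp⟩
    intro m hm
    refine ⟨∅, MeasurableSet.empty, ?_⟩
    simp
  | succ i ih =>
    obtain ⟨M, c, B, hM, hBm, hB, hc1, hcs, hpart, hfull⟩ := ih (by omega)
    obtain ⟨N', c2, B2, hN', hB2m, hB2, hc21, hc2s, hpart2, hfull2⟩ := Hp i (by omega) M
    have hNM : N ≤ M := by omega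
    let c' : ℤ → ℂ := fun k => if k < M then c k else c2 k
    have hsum : ∀ m, M ≤ m → ∀ x, ∑ k ∈ Finset.Ico N m, c' k * ex k x =
        ∑ k ∈ Finset.Ico N M, c k * ex k x + ∑ k ∈ Finset.Ico M m, c2 k * ex k x := by
      intro m hm x
      rw [← sum_Ico_split N M m hNM hm]
      refine Finset.sum_congr rfl fun k _ => ?_
      simp only [c']; split_ifs <;> rfl
    have hs1 : Ioc (0:ℝ) (2*π) \ (B ∪ B2) ⊆ Ioc (0:ℝ) (2*π) \ B := by
      intro x hx; exact ⟨hx.1, fun h => hx.2 (Or.inl h)⟩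
    have hs2 : Ioc (0:ℝ) (2*π) \ (B ∪ B2) ⊆ Ioc (0:ℝ) (2*π) \ B2 := by
      intro x hx; exact ⟨hx.1, fun h => hx.2 (Or.inr h)⟩
    have hs3 : Ioc (0:ℝ) (2*π) \ (B ∪ B2) ⊆ Ioc (0:ℝ) (2*π) := fun x hx => hx.1
    have hiJ : (0:ℝ) ≤ 2*π*(i/J) := by positivity
    have hle : 2*π*((i:ℝ)/J) ≤ 2*π*((i+1)/J) := by gcongr; linarith
    refine ⟨N', c', B ∪ B2, by push_cast; omega, hBm.union hB2m, ?_, ?_, ?_, ?_, ?_⟩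
    · refine (measure_union_le _ _).trans ((add_le_add hB hB2).trans ?_)
      rw [← ENNReal.ofReal_add (by positivity) hu1]
      apply ENNReal.ofReal_le_ofReal
      push_cast; linarith
    · intro k; simp only [c']; split_ifs
      · exact hc1 k
      · exact hc21 k
    · have : ∑ k ∈ Finset.Ico N N', ‖c' k‖^(2+δ) = ∑ k ∈ Finset.Ico N M, ‖c k‖^(2+δ) + ∑ k ∈ Finset.Ico M N', ‖c2 k‖^(2+δ) := by
        rw [← sum_Ico_split N M N' hNM hN'.le]
        refine Finset.sum_congr rfl fun k _ => ?_
        simp only [c']; split_ifs <;> rfl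
      rw [this]; push_cast; linarith
    · intro m hm
      rcases le_total m M with hmM | hmM
      · obtain ⟨A, hA, hAi⟩ := hpart m hmM
        refine ⟨A, hA, ?_⟩
        refine (lintegral_mono_set hs1).trans ?_
        refine le_trans (le_of_eq ?_) (hAi.trans (ENNReal.ofReal_le_ofReal ?_))
        · congr 1; funext x; congr 2
          refine Finset.sum_congr rfl fun k hk => ?_
          rw [Finset.mem_Ico] at hk
          simp only [c', if_pos (lt_of_lt_of_le hk.2 hmM)]
        · push_cast; linarith
      · refine ⟨Ioc 0 (2*π*(i/J)), measurableSet_Ioc, ?_⟩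
        simp only [hsum m hmM]
        calc _ ≤ ∫⁻ x in Ioc (0:ℝ) (2*π) \ (B ∪ B2), (‖∑ k ∈ Finset.Ico N M, c k * ex k x -
            (Ioc 0 (2*π*(i/J))).indicator g x‖ₑ + ‖∑ k ∈ Finset.Ico M m, c2 k * ex k x‖ₑ) := by
              apply lintegral_mono; intro x; dsimp only
              rw [add_sub_right_comm]; exact enorm_add_le _ _
          _ = (∫⁻ x in Ioc (0:ℝ) (2*π) \ (B ∪ B2), ‖∑ k ∈ Finset.Ico N M, c k * ex k x -
            (Ioc 0 (2*π*(i/J))).indicator g x‖ₑ) + ∫⁻ x in Ioc (0:ℝ) (2*π) \ (B ∪ B2), ‖∑ k ∈ Finset.Ico M m, c2 k * ex k x‖ₑ := by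
              rw [lintegral_add_right]; exact (mcont _ _).enorm
          _ ≤ ENNReal.ofReal (i*u4) + ENNReal.ofReal u3 := by
              gcongr
              · exact (lintegral_mono_set hs1).trans hfull
              · exact (lintegral_mono_set hs3).trans (hpart2 m hm)
          _ ≤ _ := by
              rw [← ENNReal.ofReal_add (by positivity) hu3]
              apply ENNReal.ofReal_le_ofReal
              push_cast; linarith
    · simp only [hsum N' hN'.le]
      have hind : ∀ x, (Ioc 0 (2*π*(((i+1:ℕ):ℝ)/J))).indicator g x = (Ioc 0 (2*π*(i/J))).indicator g x +
          (Ioc (2*π*(i/J)) (2*π*((i+1)/J))).indicator g x := by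
        intro x
        have hdisj : Disjoint (Ioc 0 (2*π*((i:ℝ)/J))) (Ioc (2*π*(i/J)) (2*π*((i+1)/J))) := by
          rw [Set.disjoint_left]; intro x h1 h2; exact absurd h1.2 (not_le.2 h2.1)
        have := congrFun (indicator_union_of_disjoint hdisj g) x
        rw [Ioc_union_Ioc_eq_Ioc hiJ hle] at this
        push_cast
        exact this
      simp only [hind]
      calc _ ≤ ∫⁻ x in Ioc (0:ℝ) (2*π) \ (B ∪ B2), (‖∑ k ∈ Finset.Ico N M, c k * ex k x -
            (Ioc 0 (2*π*(i/J))).indicator g x‖ₑ + ‖∑ k ∈ Finset.Ico M N', c2 k * ex k x - (Ioc (2*π*(i/J)) (2*π*((i+1)/J))).indicator g x‖ₑ) := by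
              apply lintegral_mono; intro x; dsimp only
              rw [add_sub_add_comm]; exact enorm_add_le _ _
        _ = (∫⁻ x in Ioc (0:ℝ) (2*π) \ (B ∪ B2), ‖∑ k ∈ Finset.Ico N M, c k * ex k x -
            (Ioc 0 (2*π*(i/J))).indicator g x‖ₑ) + ∫⁻ x in Ioc (0:ℝ) (2*π) \ (B ∪ B2), ‖∑ k ∈ Finset.Ico M N', c2 k * ex k x - (Ioc (2*π*(i/J)) (2*π*((i+1)/J))).indicator g x‖ₑ := by
              rw [lintegral_add_right]; exact ((mcont _ _).sub (hg.indicator measurableSet_Ioc)).enorm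
        _ ≤ ENNReal.ofReal (i*u4) + ENNReal.ofReal u4 := by
              gcongr
              · exact (lintegral_mono_set hs1).trans hfull
              · exact (lintegral_mono_set hs2).trans hfull2
        _ ≤ _ := by
              rw [← ENNReal.ofReal_add (by positivity) hu4]
              apply ENNReal.ofReal_le_ofReal
              push_cast; linarith

lemma block (g : ℝ → ℂ) (hg : Measurable g) (G : ℝ) (hG : 0 ≤ G) (hgG : ∀ x, ‖g x‖ ≤ G) (δ : ℝ) (hδ : 0 < δ) (N : ℤ) :
    ∃ (N' : ℤ) (c : ℤ → ℂ) (B : Set ℝ), N < N' ∧ MeasurableSet B ∧ volume B ≤ ENNReal.ofReal δ ∧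
      (∀ k, ‖c k‖ ≤ 1) ∧ ∑ k ∈ Finset.Ico N N', ‖c k‖^(2+δ) ≤ δ ∧
      (∀ m, m ≤ N' → ∃ A, MeasurableSet A ∧ ∫⁻ x in Ioc (0:ℝ) (2*π) \ B, ‖∑ k ∈ Finset.Ico N m, c k * ex k x - A.indicator g x‖ₑ ≤
        ENNReal.ofReal δ) ∧
      ∫⁻ x in Ioc (0:ℝ) (2*π) \ B, ‖∑ k ∈ Finset.Ico N N', c k * ex k x - g x‖ₑ ≤ ENNReal.ofReal δ := by
  let η : ℝ := δ / (8*π*(G+1))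
  have hη : 0 < η := by positivity
  obtain ⟨h, h0, hbad⟩ := exists_h η δ hη hδ
  let A : ℝ := 1 + ∑ k ∈ Finset.range h.natDegree, ‖h.coeff (k+1)‖
  have hS0 : 0 ≤ ∑ k ∈ Finset.range h.natDegree, ‖h.coeff (k+1)‖ := Finset.sum_nonneg fun _ _ => norm_nonneg _
  have hA1 : 1 ≤ A := by simp only [A]; linarith
  have hA0 : 0 < A := by linarith
  have t1 : Tendsto (fun J : ℕ => A*(G/(J:ℝ))) atTop (nhds 0) := by
    have := (tendsto_const_div_atTop_nhds_zero_nat G).const_mul A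
    simpa using this
  have t2 : Tendsto (fun J : ℕ => 2*π*√(A^2*(G^2/(J:ℝ)))) atTop (nhds 0) := by
    have := ((tendsto_const_div_atTop_nhds_zero_nat (G^2)).const_mul (A^2)).sqrt.const_mul (2*π)
    simpa using this
  have t3 : Tendsto (fun J : ℕ => (A*(G/(J:ℝ)))^δ * (A^2*G^2)) atTop (nhds 0) := by
    have := (t1.rpow_const (p := δ) (Or.inr hδ.le)).mul_const (A^2*G^2)
    simpa [Real.zero_rpow hδ.ne'] using this
  obtain ⟨J, ⟨⟨hJ1, hJ2⟩, hJ3⟩, hJpos⟩ := (((t1.eventually_le_const (by norm_num : (0:ℝ) < 1)).and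
    (t2.eventually_le_const (by positivity : 0 < δ/2))).and (t3.eventually_le_const hδ)).and
    (eventually_gt_atTop 0) |>.exists
  have hJ' : (0:ℝ) < J := by exact_mod_cast hJpos
  have Hp : ∀ i < J, ∀ M : ℤ, ∃ (N' : ℤ) (c : ℤ → ℂ) (B : Set ℝ), M < N' ∧ MeasurableSet B ∧ volume B ≤ ENNReal.ofReal (δ/J) ∧
      (∀ k, ‖c k‖ ≤ 1) ∧ ∑ k ∈ Finset.Ico M N', ‖c k‖^(2+δ) ≤ δ/J ∧
      (∀ m ≤ N', ∫⁻ x in Ioc (0:ℝ) (2*π), ‖∑ k ∈ Finset.Ico M m, c k * ex k x‖ₑ ≤ ENNReal.ofReal (δ/2)) ∧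
      ∫⁻ x in Ioc (0:ℝ) (2*π) \ B, ‖∑ k ∈ Finset.Ico M N', c k * ex k x -
        (Ioc (2*π*(i/J)) (2*π*((i+1)/J))).indicator g x‖ₑ ≤ ENNReal.ofReal (δ/(2*J)) := by
    intro i hi M
    obtain ⟨N', c, B, a1, a2, a3, a4, a5, a6⟩ := piece g hg G hG hgG h h0 η δ A hη hδ.le hbad (by simp only [A]; linarith) hA0.le
      J i hi M (δ/(4*A*J)) (by positivity)
    refine ⟨N', c, B, a1, a2, a3, fun k => (a4 k).trans hJ1, ?_, ?_, a6.trans (ENNReal.ofReal_le_ofReal ?_)⟩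
    · calc ∑ k ∈ Finset.Ico M N', ‖c k‖^(2+δ) ≤ ∑ k ∈ Finset.Ico M N', ‖c k‖^2 * (A*(G/J))^δ := by
            gcongr with k hk
            rw [Real.rpow_add' (norm_nonneg _) (by positivity), Real.rpow_two]
            gcongr
            exact a4 k
        _ = (∑ k ∈ Finset.Ico M N', ‖c k‖^2) * (A*(G/J))^δ := by rw [Finset.sum_mul]
        _ ≤ (A^2*(G^2/J)) * (A*(G/J))^δ := by gcongr
        _ = ((A*(G/(J:ℝ)))^δ * (A^2*G^2)) / J := by ring
        _ ≤ δ / J := by gcongr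
    · intro m hm
      refine (trig_L1 _ _).trans (ENNReal.ofReal_le_ofReal (le_trans ?_ hJ2))
      gcongr
      refine le_trans (Finset.sum_le_sum_of_subset_of_nonneg (Finset.Ico_subset_Ico_right hm) ?_) a5
      intros; positivity
    · have e1 : A * (δ/(4*A*J)) = δ/(4*J) := by field_simp
      have e2 : η*G*(2*π/J) ≤ δ/(4*J) := by
        have : η*G*(2*π/J) = δ/(4*J) * (G/(G+1)) := by simp only [η]; field_simp; ring
        rw [this]
        apply mul_le_of_le_one_right (by positivity)
        rw [div_le_one (by positivity)]; linarith
      have e3 : δ/(2*J) = δ/(4*J) + δ/(4*J) := by field_simp; ring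
      linarith
  obtain ⟨N', c, B, a1, a2, a3, a4, a5, a6, a7⟩ := block_ind g hg J hJpos N δ (δ/J) (δ/J) (δ/2) (δ/(2*J)) 0 (by positivity)
    (by positivity) (by positivity) (by positivity) Hp J le_rfl
  have e1 : (J:ℝ) * (δ/J) = δ := by field_simp
  have e2 : (J:ℝ) * (δ/(2*J)) = δ/2 := by field_simp
  have e3 : 2*π*((J:ℝ)/J) = 2*π := by field_simp
  rw [e1] at a3 a5
  rw [e2] at a7
  rw [e2, add_halves] at a6
  rw [e3] at a7
  refine ⟨N', c, B, by omega, a2, a3, a4, a5, a6, ?_⟩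
  refine le_trans (le_of_eq ?_) (a7.trans (ENNReal.ofReal_le_ofReal (by linarith)))
  refine setLIntegral_congr_fun (measurableSet_Ioc.diff a2) ?_
  intro x hx
  simp only [indicator_of_mem hx.1]


/-- State of the greedy construction. -/
lemma greedy_step {X : Type*} [SeminormedAddCommGroup X] (v : ℤ → X)
    (H : ∀ (y : X) (δ : ℝ), 0 < δ → ∀ F : Finset ℤ, ∃ l : List ℤ, l.Nodup ∧ (∀ k ∈ l, k ∉ F) ∧
      ‖(l.map v).sum - y‖ ≤ δ ∧ ∀ j, ‖((l.take j).map v).sum‖ ≤ ‖y‖ + δ) (y : X) (e : ℕ ≃ ℤ)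
    (s : ℕ) (L : List ℤ) (hL : L.Nodup) :
    ∃ (k : ℤ) (l : List ℤ), (L ++ (k :: l)).Nodup ∧ 
      (∀ i, (∀ i' < i, e i' ∈ L) → e i ∈ L ++ (k :: l)) ∧ (∀ i, e i = k → ∀ i' < i, e i' ∈ L) ∧
      ‖((L ++ (k :: l)).map v).sum - y‖ ≤ (1/2:ℝ)^s ∧
      ∀ j, ‖(((k :: l).take j).map v).sum‖ ≤ ‖(L.map v).sum - y‖ + 2*‖v k‖ + (1/2:ℝ)^s := by
  classical
  have hex : ∃ i, e i ∉ L := by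
    by_contra hc
    push Not at hc
    have : (Set.univ : Set ℤ) ⊆ (L.toFinset : Set ℤ) := by
      intro z _
      have := hc (e.symm z)
      simpa using this
    exact Set.infinite_univ ((L.toFinset.finite_toSet).subset this)
  let i0 := Nat.find hex
  have hi0 : e i0 ∉ L := Nat.find_spec hex
  have hmin : ∀ i' < i0, e i' ∈ L := fun i' h => not_not.1 (Nat.find_min hex h)
  obtain ⟨l, hl1, hl2, hl3, hl4⟩ := H (y - (L.map v).sum - v (e i0)) ((1/2:ℝ)^s) (by positivity)
    (insert (e i0) L.toFinset)
  refine ⟨e i0, l, ?_, ?_, ?_, ?_, ?_⟩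
  · rw [List.nodup_append']
    refine ⟨hL, ?_, ?_⟩
    · rw [List.nodup_cons]
      refine ⟨fun h => ?_, hl1⟩
      exact hl2 _ h (by simp)
    · rw [List.disjoint_cons_right]
      refine ⟨hi0, ?_⟩
      intro z hz hz'
      exact hl2 z hz' (by simp [hz])
  · intro i hi
    by_cases h : e i ∈ L
    · simp [h]
    · have : i = i0 := by
        apply le_antisymm
        · by_contra hlt
          push Not at hlt
          exact hi0 (hi _ hlt)
        · by_contra hlt
          push Not at hlt
          exact h (hmin _ hlt)
      simp [this]
  · intro i hi i' hi'
    have : i = i0 := e.injective hi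
    exact hmin i' (this ▸ hi')
  · convert hl3 using 2
    simp only [List.map_append, List.map_cons, List.sum_append, List.sum_cons]
    abel
  · have hbase : ‖y - (L.map v).sum - v (e i0)‖ ≤ ‖(L.map v).sum - y‖ + ‖v (e i0)‖ := by
      rw [← norm_neg ((L.map v).sum - y), neg_sub]
      exact norm_sub_le _ _
    intro j
    cases j with
    | zero => simp; positivity
    | succ j =>
      simp only [List.take_succ_cons, List.map_cons, List.sum_cons]
      have := norm_add_le (v (e i0)) ((l.take j).map v).sum
      have := hl4 j
      linarith

lemma greedy {X : Type*} [SeminormedAddCommGroup X] (v : ℤ → X)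
    (hv : ∀ δ > 0, {k | δ < ‖v k‖}.Finite)
    (H : ∀ (y : X) (δ : ℝ), 0 < δ → ∀ F : Finset ℤ, ∃ l : List ℤ, l.Nodup ∧ (∀ k ∈ l, k ∉ F) ∧
      ‖(l.map v).sum - y‖ ≤ δ ∧ ∀ j, ‖((l.take j).map v).sum‖ ≤ ‖y‖ + δ) (y : X) :
    ∃ σ : ℕ → ℤ, Function.Bijective σ ∧
      Tendsto (fun n => ‖∑ j ∈ Finset.range n, v (σ j) - y‖) atTop (nhds 0) := by
  classical
  obtain ⟨e⟩ : Nonempty (ℕ ≃ ℤ) := ⟨(Denumerable.eqv ℤ).symm⟩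
  choose! K l h1 h2 h3 h4 h5 using greedy_step v H y e
  let L : ℕ → List ℤ := fun s => Nat.rec [] (fun s L => L ++ (K s L :: l s L)) s
  have hLs : ∀ s, L (s+1) = L s ++ (K s (L s) :: l s (L s)) := fun s => rfl
  have hnd : ∀ s, (L s).Nodup := by
    intro s
    induction s with
    | zero => exact List.nodup_nil
    | succ s ih => rw [hLs]; exact h1 s _ ih
  have hlen : ∀ s, s ≤ (L s).length := by
    intro s
    induction s with
    | zero => simp
    | succ s ih => rw [hLs]; simp only [List.length_append, List.length_cons]; omega
  have hpre : ∀ s t, s ≤ t → L s <+: L t := by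
    intro s t hst
    induction t, hst using Nat.le_induction with
    | base => exact List.prefix_rfl
    | succ t _ ih => exact ih.trans (by rw [hLs]; exact List.prefix_append _ _)
  have hcov : ∀ i s, i < s → e i ∈ L s := by
    intro i
    induction i using Nat.strong_induction_on with
    | _ i ih =>
      intro s hs
      obtain ⟨t, rfl⟩ : ∃ t, s = t + 1 := ⟨s-1, by omega⟩
      rw [hLs]
      exact h2 t _ (hnd t) i (fun i' hi' => ih i' hi' t (by omega))
  let σ : ℕ → ℤ := fun j => (L (j+1))[j]'(hlen (j+1))
  have hσ : ∀ s j (hj : j < (L s).length), σ j = (L s)[j] := by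
    intro s j hj
    rcases le_total s (j+1) with h | h
    · exact ((hpre _ _ h).getElem hj).symm
    · exact ((hpre _ _ h).getElem (hlen (j+1)))
  have hsum : ∀ s n, n ≤ (L s).length → ∑ j ∈ Finset.range n, v (σ j) = (((L s).take n).map v).sum := by
    intro s n hn
    induction n with
    | zero => simp
    | succ n ih =>
      rw [Finset.sum_range_succ, ih (by omega), hσ s n (by omega), List.take_succ_eq_append_getElem (by omega), List.map_append, List.sum_append]
      simp only [List.map_cons, List.map_nil, List.sum_cons, List.sum_nil, add_zero]
  have hinj : Function.Injective σ := by
    intro a b hab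
    let s := max a b + 1
    have ha : a < (L s).length := lt_of_lt_of_le (by simp only [s]; omega) (hlen s)
    have hb : b < (L s).length := lt_of_lt_of_le (by simp only [s]; omega) (hlen s)
    rw [hσ s a ha, hσ s b hb] at hab
    exact ((hnd s).getElem_inj_iff).1 hab
  refine ⟨σ, ⟨hinj, ?_⟩, ?_⟩
  · intro z
    have := hcov (e.symm z) _ (Nat.lt_succ_self _)
    rw [Equiv.apply_symm_apply, List.mem_iff_getElem] at this
    obtain ⟨j, hj, hz⟩ := this
    exact ⟨j, by rw [hσ ((e.symm z).succ) j hj, hz]⟩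
  · have hKinj : Function.Injective (fun s => K s (L s)) := by
      have key : ∀ s t, s < t → K s (L s) ≠ K t (L t) := by
        intro s t hst heq
        have hmem : K s (L s) ∈ L t := (hpre (s+1) t hst).subset (by rw [hLs]; simp)
        have hn := hnd (t+1)
        rw [hLs, List.nodup_append'] at hn
        exact hn.2.2 hmem (by rw [heq]; simp)
      intro s t hst
      rcases lt_trichotomy s t with h | h | h
      · exact absurd hst (key _ _ h)
      · exact h
      · exact absurd hst.symm (key _ _ h)
    rw [Metric.tendsto_atTop]
    intro ε hε
    have hfin : {s | ε/16 < ‖v (K s (L s))‖}.Finite :=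
      Set.Finite.preimage (f := fun s => K s (L s)) hKinj.injOn (hv (ε/16) (by positivity))
    obtain ⟨S1, hS1⟩ := hfin.bddAbove
    obtain ⟨S2, hS2⟩ := exists_pow_lt_of_lt_one (by positivity : 0 < ε/16) (by norm_num : (1/2:ℝ) < 1)
    let S := S1 + S2 + 1
    have hsm : ∀ s, S ≤ s + 1 → (1/2:ℝ)^s ≤ ε/16 := by
      intro s hs
      refine le_trans (pow_le_pow_of_le_one (by norm_num) (by norm_num) ?_) hS2.le
      simp only [S] at hs; omega
    have hvm : ∀ s, S ≤ s → ‖v (K s (L s))‖ ≤ ε/16 := by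
      intro s hs
      by_contra hc
      push Not at hc
      have := hS1 hc
      simp only [S] at hs; omega
    have hLy : ∀ s, S ≤ s → ‖((L s).map v).sum - y‖ ≤ ε/16 := by
      intro s hs
      obtain ⟨t, rfl⟩ : ∃ t, s = t + 1 := ⟨s-1, by simp only [S] at hs; omega⟩
      rw [hLs]
      exact (h4 t _ (hnd t)).trans (hsm t hs)
    refine ⟨(L S).length, fun n hn => ?_⟩
    have hex : ∃ s, n < (L (s+1)).length := ⟨n, hlen (n+1)⟩
    let s := Nat.find hex
    have hs : n < (L (s+1)).length := Nat.find_spec hex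
    have hsS : S ≤ s := by
      by_contra hc
      push Not at hc
      have := (hpre (s+1) S hc).length_le
      omega
    have hsn : (L s).length ≤ n := by
      obtain ⟨t, ht⟩ : ∃ t, s = t + 1 := ⟨s-1, by simp only [S] at hsS; omega⟩
      rw [ht]
      exact not_lt.1 (Nat.find_min hex (by change t < s; omega))
    rw [hsum (s+1) n hs.le, hLs, List.take_append, List.take_of_length_le hsn, List.map_append, List.sum_append]
    have := h5 s _ (hnd s) (n - (L s).length)
    have a1 := hLy s hsS
    have a2 := hvm s hsS
    have a3 := hsm s (by omega)
    rw [Real.dist_eq, sub_zero, abs_norm]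
    have : ‖((L s).map v).sum + ((List.take (n - (L s).length) (K s (L s) :: l s (L s))).map v).sum - y‖ ≤
      ‖((L s).map v).sum - y‖ + ‖((List.take (n - (L s).length) (K s (L s) :: l s (L s))).map v).sum‖ := by
      rw [add_sub_right_comm]; exact norm_add_le _ _
    linarith


lemma weight (B : ℕ → Set ℝ) (hB : ∀ n, MeasurableSet (B n)) (hvB : ∀ n, volume (B n) ≤ ENNReal.ofReal ((1/2:ℝ)^n))
    (M : ℕ → ℝ) (hM : ∀ n, 0 ≤ M n) (ε : ℝ) (hε : 0 < ε) :
    ∃ (n0 : ℕ) (μ : ℝ → ℝ), Measurable μ ∧ (∀ x, 0 < μ x ∧ μ x ≤ 1) ∧ volume {x | μ x ≠ 1} < ENNReal.ofReal ε ∧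
      ∀ n ≥ n0, ∀ᵐ x, x ∈ B n → μ x * M n ≤ 1 := by
  obtain ⟨n0, hn0⟩ := exists_pow_lt_of_lt_one (by positivity : 0 < ε/2) (by norm_num : (1/2:ℝ) < 1)
  have hsumm : ∀ m : ℕ, HasSum (fun n : ℕ => (1/2:ℝ)^(n+m)) (2*(1/2)^m) := by
    intro m
    simp only [pow_add]
    exact hasSum_geometric_two.mul_right _
  have hts : ∑' n, volume (B (n+n0)) ≤ ENNReal.ofReal (2*(1/2)^n0) := by
    refine (ENNReal.tsum_le_tsum fun n => hvB (n+n0)).trans (le_of_eq ?_)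
    rw [← (hsumm n0).tsum_eq, ENNReal.ofReal_tsum_of_nonneg (fun n => by positivity) (hsumm n0).summable]
  let s : ℝ → ENNReal := fun x => ∑' n, (B (n+n0)).indicator (fun _ => ENNReal.ofReal (M (n+n0))) x
  have hs : Measurable s := Measurable.tsum fun n => measurable_const.indicator (hB _)
  have hfin : ∀ᵐ x, s x ≠ ⊤ := by
    have := ae_eventually_notMem (μ := (volume : Measure ℝ)) (s := fun n => B (n+n0)) (ne_top_of_le_ne_top ENNReal.ofReal_ne_top hts)
    filter_upwards [this] with x hx
    obtain ⟨k, hk⟩ := eventually_atTop.1 hx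
    have : s x = ∑ n ∈ Finset.range k, (B (n+n0)).indicator (fun _ => ENNReal.ofReal (M (n+n0))) x := by
      apply tsum_eq_sum
      intro n hn
      rw [indicator_of_notMem (hk n (by simpa using hn))]
    rw [this]
    apply ENNReal.sum_ne_top.2
    intro n _
    by_cases h : x ∈ B (n+n0) <;> simp [h]
  refine ⟨n0, fun x => 1/(1+(s x).toReal), ?_, ?_, ?_, ?_⟩
  · exact measurable_const.div (measurable_const.add hs.ennreal_toReal)
  · intro x
    have : 0 ≤ (s x).toReal := ENNReal.toReal_nonneg
    refine ⟨by positivity, ?_⟩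
    rw [div_le_one (by positivity)]; linarith
  · calc volume {x | 1/(1+(s x).toReal) ≠ 1} ≤ volume (⋃ n, B (n+n0)) := by
          apply measure_mono
          intro x hx
          by_contra hc
          simp only [mem_iUnion, not_exists] at hc
          apply hx
          have : s x = 0 := by simp only [s]; simp [hc]
          rw [this]; simp
      _ ≤ ∑' n, volume (B (n+n0)) := measure_iUnion_le _
      _ ≤ _ := hts
      _ < _ := by rw [ENNReal.ofReal_lt_ofReal_iff hε]; linarith
  · intro n hn
    filter_upwards [hfin] with x hx hxB
    have h1 : ENNReal.ofReal (M n) ≤ s x := by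
      have := ENNReal.le_tsum (f := fun n => (B (n+n0)).indicator (fun _ => ENNReal.ofReal (M (n+n0))) x) (n - n0)
      simp only [Nat.sub_add_cancel hn, indicator_of_mem hxB] at this
      exact this
    have h2 : M n ≤ (s x).toReal := (ENNReal.ofReal_le_iff_le_toReal hx).1 h1
    have : 0 ≤ (s x).toReal := ENNReal.toReal_nonneg
    rw [one_div, inv_mul_le_iff₀ (by positivity)]; linarith

lemma dense_family : ∃ (gs : ℕ → ℝ → ℂ) (Gs : ℕ → ℝ), (∀ n, Measurable (gs n)) ∧ (∀ n, 0 ≤ Gs n) ∧ (∀ n x, ‖gs n x‖ ≤ Gs n) ∧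
    ∀ φ : ℝ → ℂ, Continuous φ → ∀ δ > 0, ∀ n1, ∃ n ≥ n1, ∀ x ∈ Ioc (0:ℝ) (2*π), ‖gs n x - φ x‖ ≤ δ := by
  have h0 : (0:ℝ) ≤ 2*π := by positivity
  let u := TopologicalSpace.denseSeq C(Icc (0:ℝ) (2*π), ℂ)
  refine ⟨fun n => IccExtend h0 (u n.unpair.1), fun n => ‖u n.unpair.1‖, ?_, ?_, ?_, ?_⟩
  · intro n
    exact (u n.unpair.1).continuous.Icc_extend'.measurable
  · intro n; positivity
  · intro n x
    exact ContinuousMap.norm_coe_le_norm _ _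
  · intro φ hφ δ hδ n1
    let ψ : C(Icc (0:ℝ) (2*π), ℂ) := ⟨fun x => φ x, by fun_prop⟩
    obtain ⟨i, hi⟩ := (TopologicalSpace.denseRange_denseSeq C(Icc (0:ℝ) (2*π), ℂ)).exists_dist_lt ψ hδ
    refine ⟨Nat.pair i n1, Nat.right_le_pair _ _, ?_⟩
    intro x hx
    have hx' : x ∈ Icc (0:ℝ) (2*π) := Ioc_subset_Icc_self hx
    simp only [Nat.unpair_pair]
    rw [IccExtend_of_mem h0 _ hx', ← dist_eq_norm, dist_comm]
    exact (ContinuousMap.dist_apply_le_dist (f := ψ) (g := u i) ⟨x, hx'⟩).trans hi.le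

lemma coefs (gs : ℕ → ℝ → ℂ) (Gs : ℕ → ℝ) (hgs : ∀ n, Measurable (gs n)) (hGs : ∀ n, 0 ≤ Gs n) (hgG : ∀ n x, ‖gs n x‖ ≤ Gs n) :
    ∃ (C : ℤ → ℂ) (N : ℕ → ℤ) (B : ℕ → Set ℝ), (∀ k : ℤ, C (-k) = starRingEnd ℂ (C k)) ∧
      (∀ q : ℝ, 2 < q → Summable fun k : ℤ => ‖C k‖ ^ q) ∧ (∀ n : ℕ, (n:ℤ) + 1 ≤ N n) ∧ (∀ n, N n < N (n+1)) ∧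
      (∀ n, MeasurableSet (B n)) ∧ (∀ n, volume (B n) ≤ ENNReal.ofReal ((1/2:ℝ)^n)) ∧
      (∀ n m, m ≤ N (n+1) → ∃ A, MeasurableSet A ∧ ∫⁻ x in Ioc (0:ℝ) (2*π) \ B n, ‖∑ k ∈ Finset.Ico (N n) m, C k * ex k x - A.indicator (gs n) x‖ₑ ≤
        ENNReal.ofReal ((1/2:ℝ)^n)) ∧
      (∀ n, ∫⁻ x in Ioc (0:ℝ) (2*π) \ B n, ‖∑ k ∈ Finset.Ico (N n) (N (n+1)), C k * ex k x - gs n x‖ₑ ≤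
        ENNReal.ofReal ((1/2:ℝ)^n)) := by
  choose nx c B b1 b2 b3 b4 b5 b6 b7 using fun (n : ℕ) (M : ℤ) => block (gs n) (hgs n) (Gs n) (hGs n) (hgG n) ((1/2:ℝ)^n) (by positivity) M
  let N : ℕ → ℤ := fun n => Nat.rec 1 (fun n M => nx n M) n
  have hN : ∀ n, N (n+1) = nx n (N n) := fun n => rfl
  have hNlt : ∀ n, N n < N (n+1) := fun n => by rw [hN]; exact b1 _ _
  have hNge : ∀ n : ℕ, (n:ℤ) + 1 ≤ N n := by
    intro n
    induction n with
    | zero => exact le_refl _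
    | succ n ih => have := hNlt n; push_cast; omega
  have hmono : StrictMono N := strictMono_nat_of_lt_succ hNlt
  have hex : ∀ k : ℤ, ∃ n, k < N (n+1) := by
    intro k
    refine ⟨k.toNat, ?_⟩
    have := hNge (k.toNat+1)
    push_cast at this
    omega
  let idx : ℤ → ℕ := fun k => Nat.find (hex k)
  have hidx : ∀ n, ∀ k ∈ Finset.Ico (N n) (N (n+1)), idx k = n := by
    intro n k hk
    rw [Finset.mem_Ico] at hk
    simp only [idx]
    rw [Nat.find_eq_iff]
    refine ⟨hk.2, fun m hm => not_lt.2 ?_⟩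
    exact le_trans (hmono.monotone hm) hk.1
  let D : ℤ → ℂ := fun k => c (idx k) (N (idx k)) k
  let C : ℤ → ℂ := fun k => if 0 < k then D k else if k < 0 then starRingEnd ℂ (D (-k)) else 0
  have hC : ∀ n, ∀ k ∈ Finset.Ico (N n) (N (n+1)), C k = c n (N n) k := by
    intro n k hk
    have h1 := hidx n k hk
    rw [Finset.mem_Ico] at hk
    have : 0 < k := by have := hNge n; omega
    simp only [C, if_pos this, D, h1]
  have hsym : ∀ k : ℤ, C (-k) = starRingEnd ℂ (C k) := by
    intro k
    rcases lt_trichotomy k 0 with h | h | h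
    · simp only [C, if_pos (neg_pos.2 h), if_neg (not_lt.2 h.le), if_pos h, Complex.conj_conj]
    · simp [C, h]
    · simp only [C, if_neg (not_lt.2 (neg_nonpos.2 h.le)), if_pos (neg_neg_iff_pos.2 h), if_pos h, neg_neg]
  refine ⟨C, N, fun n => B n (N n), hsym, ?_, hNge, hNlt, fun n => b2 _ _, fun n => b3 _ _, ?_, ?_⟩
  · intro q hq
    let t : ℕ → ℝ := fun n => ∑ k ∈ Finset.Ico (N n) (N (n+1)), ‖C k‖^q
    have ht0 : ∀ n, 0 ≤ t n := fun n => Finset.sum_nonneg fun _ _ => by positivity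
    have ht : Summable t := by
      obtain ⟨n0, hn0⟩ := exists_pow_lt_of_lt_one (by linarith : 0 < q - 2) (by norm_num : (1/2:ℝ) < 1)
      rw [← summable_nat_add_iff n0]
      refine Summable.of_nonneg_of_le (fun n => ht0 _) (fun n => ?_) ((summable_nat_add_iff n0).2 summable_geometric_two)
      refine le_trans (Finset.sum_le_sum fun k hk => ?_) (b5 (n+n0) (N (n+n0)))
      rw [hC _ k hk]
      have hp : 2 + (1/2:ℝ)^(n+n0) ≤ q := by
        have : (1/2:ℝ)^(n+n0) ≤ (1/2)^n0 := pow_le_pow_of_le_one (by norm_num) (by norm_num) (by omega)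
        linarith
      exact Real.rpow_le_rpow_of_exponent_ge_of_imp (norm_nonneg _) (b4 _ _ _) hp (fun _ h => absurd h (by positivity))
    have hsumN : ∀ n, ∑ k ∈ Finset.Ico 1 (N n), ‖C k‖^q = ∑ i ∈ Finset.range n, t i := by
      intro n
      induction n with
      | zero => simp [N]
      | succ n ih =>
        rw [Finset.sum_range_succ, ← ih]
        have h1 : 1 ≤ N n := by have := hNge n; omega
        rw [← Finset.Ico_union_Ico_eq_Ico h1 (hNlt n).le, Finset.sum_union (Finset.Ico_disjoint_Ico_consecutive _ _ _)]
    have hnat : Summable fun n : ℕ => ‖C (n:ℤ)‖^q := by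
      rw [← summable_nat_add_iff 1]
      refine summable_of_sum_range_le (c := ∑' n, t n) (fun n => by positivity) fun n => ?_
      refine le_trans ?_ (ht.sum_le_tsum (Finset.range n) (fun i _ => ht0 i))
      rw [← hsumN]
      have : ∑ i ∈ Finset.range n, ‖C ((i+1:ℕ):ℤ)‖^q = ∑ k ∈ (Finset.range n).image (fun i : ℕ => ((i+1:ℕ):ℤ)), ‖C k‖^q := by
        rw [Finset.sum_image]
        intro a _ b _ hab
        simpa using hab
      rw [this]
      apply Finset.sum_le_sum_of_subset_of_nonneg
      · intro k hk
        simp only [Finset.mem_image, Finset.mem_range, Finset.mem_Ico] at hk ⊢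
        obtain ⟨i, hi, rfl⟩ := hk
        have := hNge n
        push_cast; omega
      · intros; positivity
    refine Summable.of_nat_of_neg hnat ?_
    simpa only [hsym, RCLike.norm_conj] using hnat
  · intro n m hm
    obtain ⟨A, hA, h⟩ := b6 n (N n) m hm
    refine ⟨A, hA, le_trans (le_of_eq ?_) h⟩
    congr 1; funext x; congr 2
    refine Finset.sum_congr rfl fun k hk => ?_
    rw [hC n k (Finset.Ico_subset_Ico_right hm hk)]
  · intro n
    refine le_trans (le_of_eq ?_) (b7 n (N n))
    congr 1; funext x; congr 2
    refine Finset.sum_congr rfl fun k hk => ?_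
    rw [hC n k hk]


lemma list_block {X : Type*} [AddCommMonoid X] (v : ℤ → X) (a b : ℤ) (hab : a ≤ b) :
    ∃ l : List ℤ, l.Nodup ∧ (∀ k ∈ l, a ≤ k) ∧ (l.map v).sum = ∑ k ∈ Finset.Ico a b, v k ∧
      ∀ j, ∃ m ≤ b, ((l.take j).map v).sum = ∑ k ∈ Finset.Ico a m, v k := by
  have hs : ∀ n : ℕ, (((List.range n).map (fun i : ℕ => a + (i:ℤ))).map v).sum = ∑ k ∈ Finset.Ico a (a+n), v k := by
    intro n
    induction n with
    | zero => simp
    | succ n ih =>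
      rw [List.range_succ, List.map_append, List.map_append, List.sum_append, ih]
      have h1 : a ≤ a + n := by omega
      have h2 : a + n ≤ a + ((n+1:ℕ):ℤ) := by push_cast; omega
      rw [← Finset.Ico_union_Ico_eq_Ico h1 h2, Finset.sum_union (Finset.Ico_disjoint_Ico_consecutive _ _ _)]
      congr 1
      have : Finset.Ico (a + (n:ℤ)) (a + ((n+1:ℕ):ℤ)) = {a + (n:ℤ)} := by
        ext z; simp only [Finset.mem_Ico, Finset.mem_singleton]; push_cast; omega
      rw [this]; simp
  refine ⟨(List.range (b-a).toNat).map (fun i : ℕ => a + (i:ℤ)), ?_, ?_, ?_, ?_⟩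
  · apply List.Nodup.map _ List.nodup_range
    intro i j h; simpa using h
  · intro k hk
    simp only [List.mem_map, List.mem_range] at hk
    obtain ⟨i, _, rfl⟩ := hk
    omega
  · rw [hs]; congr 2; omega
  · intro j
    refine ⟨a + (min j (b-a).toNat : ℕ), by omega, ?_⟩
    rw [← List.map_take, List.take_range, hs]

lemma final (gs : ℕ → ℝ → ℂ) (Gs : ℕ → ℝ) (hgs : ∀ n, Measurable (gs n)) (hGs : ∀ n, 0 ≤ Gs n) (hgG : ∀ n x, ‖gs n x‖ ≤ Gs n)
    (hdense : ∀ φ : ℝ → ℂ, Continuous φ → ∀ δ > 0, ∀ n1, ∃ n ≥ n1, ∀ x ∈ Ioc (0:ℝ) (2*π), ‖gs n x - φ x‖ ≤ δ)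
    (C : ℤ → ℂ) (N : ℕ → ℤ) (B : ℕ → Set ℝ) (hC : Summable fun k : ℤ => ‖C k‖ ^ (3:ℝ)) 
    (hN1 : ∀ n : ℕ, (n:ℤ) + 1 ≤ N n) (hN2 : ∀ n, N n < N (n+1)) (hB : ∀ n, MeasurableSet (B n))
    (hpart : ∀ n m, m ≤ N (n+1) → ∃ A, MeasurableSet A ∧ ∫⁻ x in Ioc (0:ℝ) (2*π) \ B n, ‖∑ k ∈ Finset.Ico (N n) m, C k * ex k x - A.indicator (gs n) x‖ₑ ≤
        ENNReal.ofReal ((1/2:ℝ)^n))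
    (hfull : ∀ n, ∫⁻ x in Ioc (0:ℝ) (2*π) \ B n, ‖∑ k ∈ Finset.Ico (N n) (N (n+1)), C k * ex k x - gs n x‖ₑ ≤
        ENNReal.ofReal ((1/2:ℝ)^n))
    (n0 : ℕ) (μ : ℝ → ℝ) (hμ : Measurable μ) (hμ1 : ∀ x, 0 < μ x ∧ μ x ≤ 1)
    (hμB : ∀ n ≥ n0, ∀ᵐ x, x ∈ B n → μ x * (2^n * (∑ k ∈ Finset.Ico (N n) (N (n+1)), ‖C k‖ + Gs n)) ≤ 1)
    (f : ℝ → ℂ) (hf : Measurable f) (hfi : IntegrableOn (fun x => ‖f x‖ * μ x) (Set.Icc 0 (2*π))) :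
    ∃ σ : ℕ → ℤ, Function.Bijective σ ∧
              Tendsto (fun n : ℕ =>
                  ∫ x in Set.Icc (0:ℝ) (2*π),
                    ‖(∑ j ∈ Finset.range (n+1), C (σ j) * ex (σ j) x) - f x‖ * μ x)
                atTop (nhds 0) := by
  let ρ : ℝ → ENNReal := fun x => ENNReal.ofReal (μ x)
  have hρ : Measurable ρ := hμ.ennreal_ofReal
  have hρ1 : ∀ x, ρ x ≤ 1 := fun x => by simpa [ρ] using (hμ1 x).2
  let ν : Measure ℝ := (volume.restrict (Ioc (0:ℝ) (2*π))).withDensity ρ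
  have hνle : ∀ F : ℝ → ENNReal, Measurable F → ∫⁻ x, F x ∂ν ≤ ∫⁻ x in Ioc (0:ℝ) (2*π), F x := by
    intro F hF
    rw [lintegral_withDensity_eq_lintegral_mul _ hρ hF]
    apply lintegral_mono
    intro x
    exact mul_le_of_le_one_left (by positivity) (hρ1 x)
  have hνfin : IsFiniteMeasure ν := by
    constructor
    have := hνle (fun _ => 1) measurable_const
    simp only [lintegral_const, one_mul] at this
    refine lt_of_le_of_lt this ?_
    rw [Measure.restrict_apply_univ, Real.volume_Ioc]
    exact ENNReal.ofReal_lt_top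
  have nrm : ∀ (F : ℝ → ℂ) (hF : MemLp F 1 ν) (r : ℝ), 0 ≤ r → ∫⁻ x, ‖F x‖ₑ ∂ν ≤ ENNReal.ofReal r → ‖hF.toLp F‖ ≤ r := by
    intro F hF r hr h
    rw [Lp.norm_toLp, eLpNorm_one_eq_lintegral_enorm]
    exact ENNReal.toReal_le_of_le_ofReal hr h
  have nrmb : ∀ (F : ℝ → ℂ) (hFm : Measurable F) (hF : MemLp F 1 ν) (r : ℝ), 0 ≤ r → (∀ x ∈ Ioc (0:ℝ) (2*π), ‖F x‖ ≤ r) →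
      ‖hF.toLp F‖ ≤ 2*π*r := by
    intro F hFm hF r hr h
    refine nrm F hF _ (by positivity) ((hνle _ hFm.enorm).trans ?_)
    calc ∫⁻ x in Ioc (0:ℝ) (2*π), ‖F x‖ₑ ≤ ∫⁻ x in Ioc (0:ℝ) (2*π), ENNReal.ofReal r := by
          apply setLIntegral_mono' measurableSet_Ioc
          intro x hx
          rw [← ofReal_norm]
          exact ENNReal.ofReal_le_ofReal (h x hx)
      _ = _ := by
          rw [setLIntegral_const, Real.volume_Ioc, ← ENNReal.ofReal_mul hr, sub_zero, mul_comm]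
  have mE : ∀ (S : Finset ℤ), Measurable (fun x : ℝ => ∑ k ∈ S, C k * ex k x) := by
    intro S
    have : Continuous (fun x : ℝ => ∑ k ∈ S, C k * ex k x) := by unfold ex; fun_prop
    exact this.measurable
  have bE : ∀ (S : Finset ℤ) (x : ℝ), ‖∑ k ∈ S, C k * ex k x‖ ≤ ∑ k ∈ S, ‖C k‖ := by
    intro S x
    refine (norm_sum_le _ _).trans (le_of_eq ?_)
    refine Finset.sum_congr rfl fun k _ => ?_
    rw [norm_mul, ex_norm, mul_one]
  have hT : ∀ S : Finset ℤ, MemLp (fun x : ℝ => ∑ k ∈ S, C k * ex k x) 1 ν := fun S =>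
    MemLp.of_bound (mE S).aestronglyMeasurable _ (Eventually.of_forall (bE S))
  have mE1 : ∀ k : ℤ, Measurable (fun x : ℝ => C k * ex k x) := by
    intro k; simpa using mE {k}
  have hE : ∀ k : ℤ, MemLp (fun x : ℝ => C k * ex k x) 1 ν := by
    intro k; simpa using hT {k}
  let v : ℤ → Lp ℂ 1 ν := fun k => (hE k).toLp _
  have hsum : ∀ S : Finset ℤ, ∑ k ∈ S, v k = (hT S).toLp _ := by
    classical
    intro S
    induction S using Finset.induction_on with
    | empty =>
      rw [Finset.sum_empty]
      symm
      have : MemLp.toLp (0 : ℝ → ℂ) (MemLp.zero (p := 1) (μ := ν)) = 0 := MemLp.toLp_zero _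
      rw [← this]
      congr 1
    | insert a S ha ih =>
      rw [Finset.sum_insert ha, ih, ← MemLp.toLp_add]
      congr 1
      funext x
      simp [Finset.sum_insert ha]
  have hgL : ∀ n, ∀ A, MeasurableSet A → MemLp (A.indicator (gs n)) 1 ν := fun n A hA =>
    MemLp.of_bound ((hgs n).indicator hA).aestronglyMeasurable (Gs n)
      (Eventually.of_forall fun x => (norm_indicator_le_norm_self _ _).trans (hgG n x))
  have hgL' : ∀ n, MemLp (gs n) 1 ν := fun n =>
    MemLp.of_bound (hgs n).aestronglyMeasurable (Gs n) (Eventually.of_forall fun x => hgG n x)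
  have hkey : ∀ n ≥ n0, ∀ m ≤ N (n+1), ∀ A, ∀ hA : MeasurableSet A,
      ∫⁻ x in Ioc (0:ℝ) (2*π) \ B n, ‖∑ k ∈ Finset.Ico (N n) m, C k * ex k x - A.indicator (gs n) x‖ₑ ≤ ENNReal.ofReal ((1/2:ℝ)^n) →
      ‖∑ k ∈ Finset.Ico (N n) m, v k - (hgL n A hA).toLp _‖ ≤ (1 + 2*π)*(1/2)^n := by
    intro n hn m hm A hA h
    have hFm : Measurable (fun x : ℝ => ∑ k ∈ Finset.Ico (N n) m, C k * ex k x - A.indicator (gs n) x) := 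
      (mE _).sub ((hgs n).indicator hA)
    rw [hsum, ← MemLp.toLp_sub]
    refine nrm _ _ _ (by positivity) ?_
    change ∫⁻ x, ‖∑ k ∈ Finset.Ico (N n) m, C k * ex k x - A.indicator (gs n) x‖ₑ ∂ν ≤ _
    rw [lintegral_withDensity_eq_lintegral_mul _ hρ hFm.enorm, ← lintegral_inter_add_sdiff _ _ (hB n), add_mul, one_mul,
      ENNReal.ofReal_add (by positivity) (by positivity), add_comm]
    gcongr
    · refine le_trans (lintegral_mono fun x => ?_) h
      exact mul_le_of_le_one_left (by positivity) (hρ1 x)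
    · calc _ ≤ ∫⁻ x in Ioc (0:ℝ) (2*π) ∩ B n, ENNReal.ofReal ((1/2)^n) := by
            apply setLIntegral_mono_ae' (measurableSet_Ioc.inter (hB n))
            filter_upwards [hμB n hn] with x hx hxB
            have hx := hx hxB.2
            simp only [Pi.mul_apply, ρ]
            rw [← ofReal_norm, ← ENNReal.ofReal_mul (hμ1 x).1.le]
            apply ENNReal.ofReal_le_ofReal
            have h1 : ‖∑ k ∈ Finset.Ico (N n) m, C k * ex k x - A.indicator (gs n) x‖ ≤ 
                ∑ k ∈ Finset.Ico (N n) (N (n+1)), ‖C k‖ + Gs n := by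
              refine (norm_sub_le _ _).trans (add_le_add ((bE _ x).trans ?_) ((norm_indicator_le_norm_self _ _).trans (hgG n x)))
              exact Finset.sum_le_sum_of_subset_of_nonneg (Finset.Ico_subset_Ico_right hm) (fun _ _ _ => norm_nonneg _)
            refine (mul_le_mul_of_nonneg_left h1 (hμ1 x).1.le).trans ?_
            rw [one_div, inv_pow, ← one_div, le_div_iff₀ (by positivity)]
            linarith
        _ ≤ ∫⁻ x in Ioc (0:ℝ) (2*π), ENNReal.ofReal ((1/2)^n) := lintegral_mono_set inter_subset_left
        _ = _ := by
            rw [setLIntegral_const, Real.volume_Ioc, sub_zero, mul_comm, ← ENNReal.ofReal_mul (p := 2*π) (by positivity)]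
  have hind : ∀ n A hA, ‖(hgL n A hA).toLp _‖ ≤ ‖(hgL' n).toLp _‖ := by
    intro n A hA
    rw [Lp.norm_toLp, Lp.norm_toLp]
    apply ENNReal.toReal_mono (hgL' n).2.ne
    exact eLpNorm_indicator_le _
  have hv : ∀ δ > 0, {k | δ < ‖v k‖}.Finite := by
    intro δ hδ
    have h1 := hC.tendsto_cofinite_zero
    have h2 := h1.eventually_lt_const (by positivity : 0 < (δ/(2*π))^(3:ℝ))
    rw [eventually_cofinite] at h2
    refine h2.subset ?_
    intro k hk hlt
    rw [Real.rpow_lt_rpow_iff (norm_nonneg _) (by positivity) (by norm_num), lt_div_iff₀ (by positivity)] at hlt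
    have := nrmb _ (mE1 k) (hE k) ‖C k‖ (norm_nonneg _) (fun x _ => by rw [norm_mul, ex_norm, mul_one])
    have hk' : δ < ‖v k‖ := hk
    have : ‖v k‖ ≤ 2*π*‖C k‖ := this
    linarith
  have H : ∀ (y : Lp ℂ 1 ν) (δ : ℝ), 0 < δ → ∀ F : Finset ℤ, ∃ l : List ℤ, l.Nodup ∧ (∀ k ∈ l, k ∉ F) ∧
      ‖(l.map v).sum - y‖ ≤ δ ∧ ∀ j, ‖((l.take j).map v).sum‖ ≤ ‖y‖ + δ := by
    intro y δ hδ F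
    obtain ⟨φ, hφ1, hφ2⟩ := (Lp.memLp y).exists_boundedContinuous_eLpNorm_sub_le ENNReal.one_ne_top
      (ε := ENNReal.ofReal (δ/4)) (by simpa using hδ)
    obtain ⟨bF, hbF⟩ := F.bddAbove
    obtain ⟨n2, hn2⟩ := exists_pow_lt_of_lt_one (by positivity : 0 < δ/4/(1+2*π)) (by norm_num : (1/2:ℝ) < 1)
    obtain ⟨n, hn, hnφ⟩ := hdense φ φ.continuous (δ/4/(2*π)) (by positivity) (n0 + n2 + bF.toNat)
    have hsmall : (1+2*π)*(1/2:ℝ)^n ≤ δ/4 := by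
      have : (1/2:ℝ)^n ≤ (1/2)^n2 := pow_le_pow_of_le_one (by norm_num) (by norm_num) (by omega)
      have h2 := this.trans hn2.le
      rw [le_div_iff₀ (by positivity)] at h2
      linarith
    have hyφ : ‖y - hφ2.toLp φ‖ ≤ δ/4 := by
      rw [Lp.norm_def]
      apply ENNReal.toReal_le_of_le_ofReal (by positivity)
      refine le_trans (le_of_eq (eLpNorm_congr_ae ?_)) hφ1
      filter_upwards [Lp.coeFn_sub y (hφ2.toLp φ), hφ2.coeFn_toLp] with x h1 h2
      rw [h1]; simp [h2]
    have hgφ : ‖(hgL' n).toLp _ - hφ2.toLp φ‖ ≤ δ/4 := by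
      rw [← MemLp.toLp_sub]
      have := nrmb _ ((hgs n).sub φ.continuous.measurable) ((hgL' n).sub hφ2) (δ/4/(2*π)) (by positivity) hnφ
      refine this.trans (le_of_eq ?_)
      field_simp
    have hyg : ‖(hgL' n).toLp _ - y‖ ≤ δ/2 := by
      have h1 : (hgL' n).toLp _ - y = ((hgL' n).toLp _ - hφ2.toLp φ) - (y - hφ2.toLp φ) := by abel
      rw [h1]
      have := norm_sub_le ((hgL' n).toLp _ - hφ2.toLp φ) (y - hφ2.toLp φ)
      linarith
    obtain ⟨l, l1, l2, l3, l4⟩ := list_block v (N n) (N (n+1)) (hN2 n).le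
    refine ⟨l, l1, ?_, ?_, ?_⟩
    · intro k hk hkF
      have h1 := l2 k hk
      have h2 := hbF hkF
      have h3 := hN1 n
      omega
    · rw [l3]
      have h1 := hkey n (by omega) _ le_rfl univ MeasurableSet.univ (by simpa only [indicator_univ] using hfull n)
      simp only [indicator_univ] at h1
      have h2 : ∑ k ∈ Finset.Ico (N n) (N (n+1)), v k - y = (∑ k ∈ Finset.Ico (N n) (N (n+1)), v k - (hgL' n).toLp _) + ((hgL' n).toLp _ - y) := by abel
      rw [h2]
      refine (norm_add_le _ _).trans ?_
      linarith
    · intro j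
      obtain ⟨m, hm, hj⟩ := l4 j
      obtain ⟨A, hA, hAi⟩ := hpart n m hm
      rw [hj]
      have h1 := hkey n (by omega) m hm A hA hAi
      have h2 := hind n A hA
      have h3 := norm_sub_norm_le (∑ k ∈ Finset.Ico (N n) m, v k) ((hgL n A hA).toLp _)
      have h4 := norm_sub_norm_le ((hgL' n).toLp _) y
      linarith
  have hconv : ∀ F : ℝ → ℂ, ∫ x, ‖F x‖ ∂ν = ∫ x in Set.Icc (0:ℝ) (2*π), ‖F x‖ * μ x := by
    intro F
    have hν' : ν = (volume.restrict (Ioc (0:ℝ) (2*π))).withDensity (fun x => ((μ x).toNNReal : ENNReal)) := rfl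
    rw [hν', integral_withDensity_eq_integral_smul hμ.real_toNNReal, Measure.restrict_congr_set Ioc_ae_eq_Icc]
    congr 1
    funext x
    rw [NNReal.smul_def, Real.coe_toNNReal _ (hμ1 x).1.le, smul_eq_mul, mul_comm]
  have hfL : MemLp f 1 ν := by
    rw [memLp_one_iff_integrable, ← integrable_norm_iff hf.aestronglyMeasurable]
    rw [integrable_withDensity_iff hρ (Eventually.of_forall fun x => ENNReal.ofReal_lt_top)]
    have : IntegrableOn (fun x => ‖f x‖ * μ x) (Set.Ioc 0 (2*π)) := hfi.mono_set Ioc_subset_Icc_self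
    refine this.congr (Eventually.of_forall fun x => ?_)
    simp only [ρ, ENNReal.toReal_ofReal (hμ1 x).1.le]
  obtain ⟨σ, hσ, hlim⟩ := greedy v hv H (hfL.toLp f)
  refine ⟨σ, hσ, ?_⟩
  have hlim' := hlim.comp (tendsto_add_atTop_nat 1)
  refine hlim'.congr fun n => ?_
  simp only [Function.comp]
  rw [← hconv]
  have hs : ∑ j ∈ Finset.range (n+1), v (σ j) = ∑ k ∈ (Finset.range (n+1)).image σ, v k := by
    rw [Finset.sum_image hσ.1.injOn]
  have hm := (hT ((Finset.range (n+1)).image σ)).sub hfL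
  rw [hs, hsum, ← MemLp.toLp_sub, Lp.norm_toLp, eLpNorm_one_eq_lintegral_enorm, ← integral_norm_eq_lintegral_enorm hm.1]
  congr 1
  funext x
  simp only [Pi.sub_apply]
  rw [Finset.sum_image hσ.1.injOn]

theorem stmt0 :
    ∃ C : ℤ → ℂ,
      (∀ k : ℤ, C (-k) = starRingEnd ℂ (C k)) ∧
      (∀ q : ℝ, 2 < q → Summable fun k : ℤ => ‖C k‖ ^ q) ∧
      (∀ ε : ℝ, 0 < ε →
        ∃ μ : ℝ → ℝ, Measurable μ ∧
          (∀ x ∈ Set.Icc (0:ℝ) (2*π), 0 < μ x ∧ μ x ≤ 1) ∧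
          volume {x ∈ Set.Icc (0:ℝ) (2*π) | μ x ≠ 1} < ENNReal.ofReal ε ∧
          ∀ f : ℝ → ℂ, Measurable f →
            IntegrableOn (fun x => ‖f x‖ * μ x) (Set.Icc 0 (2*π)) →
            ∃ σ : ℕ → ℤ, Function.Bijective σ ∧
              Tendsto (fun n : ℕ =>
                  ∫ x in Set.Icc (0:ℝ) (2*π),
                    ‖(∑ j ∈ Finset.range (n+1),
                        C (σ j) * Complex.exp (Complex.I * (σ j : ℂ) * (x:ℂ))) - f x‖ * μ x)
                atTop (nhds 0)) := by
  obtain ⟨gs, Gs, d1, d2, d3, d4⟩ := dense_family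
  obtain ⟨C, N, B, c1, c2, c3, c4, c5, c6, c7, c8⟩ := coefs gs Gs d1 d2 d3
  refine ⟨C, c1, c2, fun ε hε => ?_⟩
  obtain ⟨n0, μ, m1, m2, m3, m4⟩ := weight B c5 c6
    (fun n => 2^n * (∑ k ∈ Finset.Ico (N n) (N (n+1)), ‖C k‖ + Gs n))
    (fun n => by have := d2 n; positivity) ε hε
  refine ⟨μ, m1, fun x _ => m2 x, lt_of_le_of_lt (measure_mono fun x hx => hx.2) m3, ?_⟩
  intro f hf hfi
  exact final gs Gs d1 d2 d3 d4 C N B (c2 3 (by norm_num)) c3 c4 c5 c7 c8 n0 μ m1 m2 m4 f hf hfi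
end

section
/- Let 0 < ε < 1/2, let N₀ > 2 be a natural number, and let f = ∑_{s=1}^q γ_s · χ_{Δ_s} be a step function where each Δ_s is a dyadic interval [(i−1)/2^m, i/2^m] (scaled to [0,2π]) and |γ_s| · √|Δ_s| < ε³ · (8 ∫_0^{2π} f²)^{−1} for all s. Then there exist a measurable set E ⊆ [0,2π] with |E| > 2π − ε, a natural number N > N₀, and complex coefficients C_k for N₀ ≤ |k| < N with C_{−k} = conj(C_k), such that: ∫_E |∑_{N₀≤|k|<N} C_k e^{ikx} − f(x)| dx < ε; ∑_{N₀≤|k|<N} |C_k|^{2+ε} < ε; and for every N₀ ≤ m < N and every measurable subset e ⊆ E, ∫_e |∑_{N₀≤|k|≤m} C_k e^{ikx}| dx < ε + ∫_e |f(x)| dx. -/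
open MeasureTheory Real Complex Set Filter

noncomputable def tp (K : Finset ℤ) (c : ℤ → ℂ) (x : ℝ) : ℂ :=
  ∑ k ∈ K, c k * Complex.exp (Complex.I * (k:ℂ) * (x:ℂ))

lemma tp_cont (K : Finset ℤ) (c : ℤ → ℂ) : Continuous (tp K c) := by
  unfold tp; fun_prop

lemma exp_int_norm (k : ℤ) (x : ℝ) : ‖Complex.exp (Complex.I * (k:ℂ) * (x:ℂ))‖ = 1 := by
  have : Complex.I * (k:ℂ) * (x:ℂ) = ((k * x : ℝ) : ℂ) * Complex.I := by push_cast; ring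
  rw [this, Complex.norm_exp_ofReal_mul_I]

lemma tp_bound (K : Finset ℤ) (c : ℤ → ℂ) (x : ℝ) : ‖tp K c x‖ ≤ ∑ k ∈ K, ‖c k‖ := by
  unfold tp
  refine (norm_sum_le _ _).trans (Finset.sum_le_sum fun k _ => ?_)
  rw [norm_mul, exp_int_norm, mul_one]

lemma exp_int_per (k : ℤ) (x : ℝ) :
    Complex.exp (Complex.I * (k:ℂ) * ((x + 2 * π : ℝ):ℂ)) = Complex.exp (Complex.I * (k:ℂ) * (x:ℂ)) := by
  have : Complex.I * (k:ℂ) * ((x + 2 * π : ℝ):ℂ) = Complex.I * (k:ℂ) * (x:ℂ) + k * (2 * π * Complex.I) := by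
    push_cast; ring
  rw [this, Complex.exp_add, Complex.exp_int_mul_two_pi_mul_I, mul_one]

lemma tp_per (K : Finset ℤ) (c : ℤ → ℂ) : Function.Periodic (tp K c) (2 * π) := by
  intro x
  unfold tp
  refine Finset.sum_congr rfl fun k _ => ?_
  rw [exp_int_per]

lemma exp_int_integral (k : ℤ) :
    ∫ x in (0:ℝ)..(2*π), Complex.exp (Complex.I * (k:ℂ) * (x:ℂ)) = if k = 0 then (2 * π : ℂ) else 0 := by
  split_ifs with h
  · subst h; simp
  · have hk : Complex.I * (k:ℂ) ≠ 0 := by simp [h]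
    rw [integral_exp_mul_complex hk]
    have := exp_int_per k 0
    simp only [zero_add] at this
    rw [this]; simp

lemma parseval (K : Finset ℤ) (c : ℤ → ℂ) :
    ∫ x in (0:ℝ)..(2*π), ‖tp K c x‖^2 = 2 * π * ∑ k ∈ K, ‖c k‖^2 := by
  have h1 : ∀ x, ((‖tp K c x‖^2 : ℝ) : ℂ) = ∑ k ∈ K, ∑ l ∈ K, (c k * starRingEnd ℂ (c l)) * Complex.exp (Complex.I * ((k - l : ℤ):ℂ) * (x:ℂ)) := by
    intro x
    rw [Complex.ofReal_pow, ← Complex.mul_conj']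
    unfold tp
    rw [map_sum, Finset.sum_mul_sum]
    refine Finset.sum_congr rfl fun k _ => Finset.sum_congr rfl fun l _ => ?_
    rw [map_mul, ← Complex.exp_conj]
    have : Complex.I * ((k - l : ℤ):ℂ) * (x:ℂ) = Complex.I * (k:ℂ) * (x:ℂ) + 
      (starRingEnd ℂ) (Complex.I * (l:ℂ) * (x:ℂ)) := by
      simp; ring
    rw [this, Complex.exp_add]; ring
  have h2 : ((∫ x in (0:ℝ)..(2*π), ‖tp K c x‖^2 : ℝ) : ℂ) = ((2 * π * ∑ k ∈ K, ‖c k‖^2 : ℝ) : ℂ) := by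
    rw [← intervalIntegral.integral_ofReal]
    rw [intervalIntegral.integral_congr (fun x _ => h1 x)]
    rw [intervalIntegral.integral_finsetSum]
    · rw [Complex.ofReal_mul, Complex.ofReal_sum, Finset.mul_sum]
      refine Finset.sum_congr rfl fun k hk => ?_
      rw [intervalIntegral.integral_finsetSum]
      · simp_rw [intervalIntegral.integral_const_mul, exp_int_integral]
        rw [Finset.sum_eq_single k]
        · simp [Complex.mul_conj']; ring
        · intro l _ hl
          rw [if_neg (by omega), mul_zero]
        · intro h; exact absurd hk h
      · intro l _
        exact Continuous.intervalIntegrable (by fun_prop) _ _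
    · intro l _
      exact Continuous.intervalIntegrable (by fun_prop) _ _
  exact_mod_cast h2

lemma per_int {g : ℝ → ℝ} (hg : Function.Periodic g (2*π)) 
    (hi : IntervalIntegrable g volume 0 (2*π)) (ν : ℕ) (hν : 1 ≤ ν) :
    IntervalIntegrable (fun x => g (ν * x)) volume 0 (2*π) ∧
    ∫ x in (0:ℝ)..(2*π), g (ν * x) = ∫ x in (0:ℝ)..(2*π), g x := by
  have hν0 : (ν:ℝ) ≠ 0 := by positivity
  have h2 := hg.intervalIntegrable₀ (by positivity) hi
  constructor
  · have := (h2 0 (ν * (2*π))).comp_mul_left (c := (ν:ℝ))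
    simpa [hν0] using this
  · rw [intervalIntegral.integral_comp_mul_left _ hν0]
    have := hg.intervalIntegral_add_zsmul_eq ν 0 h2
    simp only [zero_add, zsmul_eq_mul, Int.cast_natCast] at this
    rw [mul_zero, this, smul_eq_mul]
    field_simp

noncomputable def wf (d : ℝ) (x : ℝ) : ℝ := if Int.fract (x / (2*π)) < d then 1 else 0

lemma wf_meas (d : ℝ) : Measurable (wf d) := by
  unfold wf
  refine Measurable.ite ?_ measurable_const measurable_const
  exact measurableSet_lt (measurable_fract.comp (by fun_prop)) measurable_const

lemma wf_per (d : ℝ) : Function.Periodic (wf d) (2*π) := by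
  intro x
  unfold wf
  have : (x + 2*π) / (2*π) = x/(2*π) + 1 := by field_simp
  rw [this, Int.fract_add_one]

lemma wf_int_able (d : ℝ) (a b : ℝ) : IntervalIntegrable (wf d) volume a b := by
  refine (intervalIntegrable_const (c := (1:ℝ))).mono_fun (wf_meas d).aestronglyMeasurable ?_
  filter_upwards with x
  unfold wf; split_ifs <;> simp

lemma wf_integral (d : ℝ) (h0 : 0 < d) (h1 : d < 1) : ∫ x in (0:ℝ)..(2*π), wf d x = 2 * π * d := by
  have hp := Real.pi_pos
  rw [← intervalIntegral.integral_add_adjacent_intervals (b := 2*π*d) (wf_int_able _ _ _) (wf_int_able _ _ _)]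
  have e1 : ∫ x in (0:ℝ)..(2*π*d), wf d x = ∫ x in (0:ℝ)..(2*π*d), (1:ℝ) := by
    apply intervalIntegral.integral_congr_ae
    have : ∀ᵐ x : ℝ, x ≠ 2*π*d := by simp [ae_iff]
    filter_upwards [this] with x hne hx
    rw [uIoc_of_le (by positivity)] at hx
    have hlt : x < 2*π*d := lt_of_le_of_ne hx.2 hne
    have hx0 := hx.1
    have h3 : x / (2*π) < d := by rw [div_lt_iff₀ (by positivity)]; linarith
    unfold wf
    rw [Int.fract_eq_self.2 ⟨by positivity, by linarith⟩, if_pos h3]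
  have e2 : ∫ x in (2*π*d)..(2*π), wf d x = ∫ x in (2*π*d)..(2*π), (0:ℝ) := by
    apply intervalIntegral.integral_congr_ae
    have : ∀ᵐ x : ℝ, x ≠ 2*π := by simp [ae_iff]
    filter_upwards [this] with x hne hx
    rw [uIoc_of_le (by nlinarith)] at hx
    have hlt : x < 2*π := lt_of_le_of_ne hx.2 hne
    have hx0 : 2*π*d < x := hx.1
    have h3 : d ≤ x / (2*π) := by rw [le_div_iff₀ (by positivity)]; linarith
    have h4 : x / (2*π) < 1 := by rw [div_lt_iff₀ (by positivity)]; linarith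
    unfold wf
    rw [Int.fract_eq_self.2 ⟨by linarith, h4⟩, if_neg (by linarith)]
  rw [e1, e2]; simp

lemma block_s2 (d n ν : ℕ) (t a : ℤ → ℂ) (ht : ∀ k, t (-k) = starRingEnd ℂ (t k))
    (ha : ∀ k, a (-k) = starRingEnd ℂ (a k)) (ha0 : a 0 = 0) :
    ∃ c : ℤ → ℂ, (∀ k, c (-k) = starRingEnd ℂ (c k)) ∧
      (∀ k, c k ≠ 0 → (ν:ℤ) - d ≤ |k| ∧ |k| ≤ n * ν + d) ∧
      ∀ (K : Finset ℤ) (x : ℝ), Finset.Icc (-((n:ℤ)*ν+d)) (n*ν+d) ⊆ K →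
        tp K c x = tp (Finset.Icc (-(d:ℤ)) d) t x * tp (Finset.Icc (-(n:ℤ)) n) a (ν * x) := by
  classical
  have key : ∀ j ∈ Finset.Icc (-(n:ℤ)) n, ∀ l ∈ Finset.Icc (-(d:ℤ)) d, |j * ν + l| ≤ n*ν+d := by
    intro j hj l hl
    rw [Finset.mem_Icc] at hj hl
    have h1 : |j| ≤ n := abs_le.2 hj
    have h2 : |l| ≤ d := abs_le.2 hl
    calc |j * ν + l| ≤ |j * ν| + |l| := abs_add_le _ _
      _ = |j| * ν + |l| := by rw [abs_mul, Nat.abs_cast]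
      _ ≤ _ := by gcongr
  refine ⟨fun k => ∑ j ∈ Finset.Icc (-(n:ℤ)) n, ∑ l ∈ Finset.Icc (-(d:ℤ)) d,
    if j * ν + l = k then a j * t l else 0, ?_, ?_, ?_⟩
  · intro k
    have neg : ∀ (r : ℕ) (F : ℤ → ℂ), ∑ j ∈ Finset.Icc (-(r:ℤ)) r, F j = ∑ j ∈ Finset.Icc (-(r:ℤ)) r, F (-j) := by
      intro r F
      refine Finset.sum_nbij' (fun j => -j) (fun j => -j) ?_ ?_ ?_ ?_ ?_ <;> intro j hj <;>
        simp only [Finset.mem_Icc, neg_neg] at * <;> omega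
    simp only [map_sum]
    rw [neg n]
    refine Finset.sum_congr rfl fun j _ => ?_
    rw [neg d]
    refine Finset.sum_congr rfl fun l _ => ?_
    have : (-j * (ν:ℤ) + -l = -k) ↔ (j * ν + l = k) := by
      constructor <;> intro h <;> linarith
    simp only [this]
    split_ifs
    · rw [map_mul, ht, ha]
    · simp
  · intro k hk
    obtain ⟨j, hj, hk⟩ := Finset.exists_ne_zero_of_sum_ne_zero hk
    obtain ⟨l, hl, hk⟩ := Finset.exists_ne_zero_of_sum_ne_zero hk
    split_ifs at hk with h
    · subst h
      refine ⟨?_, key j hj l hl⟩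
      have hj0 : j ≠ 0 := by rintro rfl; simp [ha0] at hk
      have h1 : 1 ≤ |j| := Int.one_le_abs hj0
      rw [Finset.mem_Icc] at hl
      have h2 : |l| ≤ d := abs_le.2 hl
      have h3 : |j * ν| ≤ |j * ν + l| + |l| := by
        have := abs_sub (j * (ν:ℤ) + l) l
        simpa using this
      rw [abs_mul, Nat.abs_cast] at h3
      nlinarith
    · exact absurd rfl hk
  · intro K x hK
    rw [mul_comm]
    unfold tp
    rw [Finset.sum_mul_sum]
    simp only [Finset.sum_mul]
    rw [Finset.sum_comm]
    refine Finset.sum_congr rfl fun j hj => ?_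
    rw [Finset.sum_comm]
    refine Finset.sum_congr rfl fun l hl => ?_
    rw [Finset.sum_eq_single (j * ν + l)]
    · rw [if_pos rfl]
      have : Complex.I * ((j * ν + l : ℤ):ℂ) * (x:ℂ) = Complex.I * (l:ℂ) * (x:ℂ) + Complex.I * (j:ℂ) * ((ν * x : ℝ):ℂ) := by
        push_cast; ring
      rw [this, Complex.exp_add]; ring
    · intro b _ hb
      rw [if_neg (Ne.symm hb), zero_mul]
    · intro h
      exact absurd (hK (Finset.mem_Icc.2 (abs_le.1 (key j hj l hl)))) h

lemma fourier_approx_s2 (h : ℝ → ℝ) (hm : Measurable h) (M : ℝ) (hM : ∀ x, |h x| ≤ M)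
    (η : ℝ) (hη : 0 < η) :
    ∃ (n : ℕ) (c : ℤ → ℂ), (∀ k, c (-k) = starRingEnd ℂ (c k)) ∧
      c 0 = (((2*π)⁻¹ * ∫ x in (0:ℝ)..(2*π), h x : ℝ) : ℂ) ∧
      (∫ x in (0:ℝ)..(2*π), ‖tp (Finset.Icc (-(n:ℤ)) n) c x - (h x : ℂ)‖) < η ∧
      2 * π * ∑ k ∈ Finset.Icc (-(n:ℤ)) n, ‖c k‖^2 ≤ ∫ x in (0:ℝ)..(2*π), (h x)^2 := by
  have hp : 0 < 2 * π := by positivity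
  have : Fact (0 < 2 * π) := ⟨hp⟩
  have hL : MemLp (fun x => (h x : ℂ)) 2 (volume.restrict (Ioc 0 (0 + 2*π))) := by
    refine MemLp.of_bound (by fun_prop) M ?_
    filter_upwards with x
    rw [Complex.norm_real]; exact hM x
  have hF := (memLp_haarAddCircle_iff (p := 2)).2 hL.memLp_liftIoc
  set F := AddCircle.liftIoc (2*π) 0 (fun x => (h x : ℂ)) with hFdef
  set g := hF.toLp with hg
  set c : ℤ → ℂ := fun k => fourierCoeff F k with hc
  have hcg : ∀ k, fourierCoeff g k = c k := fun k => by
    rw [hg, fourierCoeff_congr_ae hF.coeFn_toLp]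
  have hci : ∀ k, c k = (1/(2*π)) • ∫ x in (0:ℝ)..(2*π), Complex.exp (Complex.I * ((-k:ℤ):ℂ) * x) * (h x : ℂ) := by
    intro k
    rw [hc]
    simp only
    rw [fourierCoeff_eq_intervalIntegral F k 0, zero_add]
    congr 1
    apply intervalIntegral.integral_congr_ae
    filter_upwards with x hx
    rw [uIoc_of_le hp.le] at hx
    rw [hFdef, AddCircle.liftIoc_coe_apply (by simpa using hx), fourier_coe_apply, smul_eq_mul]
    congr 2
    have : (π:ℂ) ≠ 0 := by exact_mod_cast Real.pi_ne_zero
    push_cast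
    field_simp
  have hs := hasSum_fourier_series_L2 g
  simp only [hcg] at hs
  have htend : Tendsto (fun n : ℕ => Finset.Icc (-(n:ℤ)) n) atTop atTop := by
    refine tendsto_atTop_finset_of_monotone ?_ ?_
    · intro a b hab
      apply Finset.Icc_subset_Icc <;> omega
    · intro x
      exact ⟨x.natAbs, by rw [Finset.mem_Icc]; omega⟩
  have h1 := Metric.tendsto_atTop.1 (hs.comp htend) (η / (2*π)) (by positivity)
  obtain ⟨n, hn⟩ := h1
  have hn := hn n le_rfl
  refine ⟨n, c, ?_, ?_, ?_, ?_⟩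
  · intro k
    rw [hci, hci]
    rw [Complex.real_smul, Complex.real_smul, map_mul, Complex.conj_ofReal]
    congr 1
    rw [← intervalIntegral.intervalIntegral_conj] 
    apply intervalIntegral.integral_congr
    intro x _
    simp only [map_mul, Complex.conj_ofReal, ← Complex.exp_conj]
    simp
  · rw [hci]
    simp [← intervalIntegral.integral_ofReal]
  · set G : AddCircle (2*π) → ℂ := fun t => ∑ k ∈ Finset.Icc (-(n:ℤ)) n, c k * fourier k t with hG
    have hGm : AEStronglyMeasurable G (AddCircle.haarAddCircle) := by
      apply Continuous.aestronglyMeasurable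
      rw [hG]
      exact continuous_finsetSum _ fun k _ => continuous_const.mul (map_continuous (fourier k))
    have hae : (↑↑(∑ k ∈ Finset.Icc (-(n:ℤ)) n, c k • fourierLp (T := 2*π) 2 k - g) : AddCircle (2*π) → ℂ) =ᵐ[AddCircle.haarAddCircle] fun t => G t - F t := by
      have e1 := Lp.coeFn_sub (∑ k ∈ Finset.Icc (-(n:ℤ)) n, c k • fourierLp (T := 2*π) 2 k) g
      have e2 := Lp.coeFn_finsetSum (Finset.Icc (-(n:ℤ)) n) (fun k => c k • (fourierLp 2 k : Lp ℂ 2 (@AddCircle.haarAddCircle (2*π) _)))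
      have e3 : ∀ᵐ t ∂(@AddCircle.haarAddCircle (2*π) _), ∀ k : ℤ, (c k • (fourierLp 2 k : Lp ℂ 2 (@AddCircle.haarAddCircle (2*π) _))) t = c k * fourier k t := by
        rw [ae_all_iff]
        intro k
        filter_upwards [Lp.coeFn_smul (c k) (fourierLp 2 k : Lp ℂ 2 (@AddCircle.haarAddCircle (2*π) _)), coeFn_fourierLp (T := 2*π) 2 k] with t h1 h2
        rw [h1, Pi.smul_apply, h2, smul_eq_mul]
      filter_upwards [e1, e2, e3, hF.coeFn_toLp] with t h1 h2 h3 h4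
      rw [h1, Pi.sub_apply, h2, h4]
      simp only [Finset.sum_apply, h3, hG]
    have hd : eLpNorm (fun t => G t - F t) 2 AddCircle.haarAddCircle < ENNReal.ofReal (η/(2*π)) := by
      rw [← eLpNorm_congr_ae hae, ← Lp.enorm_def, ← ofReal_norm]
      rw [ENNReal.ofReal_lt_ofReal_iff (by positivity)]
      simpa [dist_eq_norm] using hn
    have hm1 : AEStronglyMeasurable (fun t => G t - F t) (AddCircle.haarAddCircle) := hGm.sub hF.1
    have hd1 : eLpNorm (fun t => G t - F t) 1 AddCircle.haarAddCircle < ENNReal.ofReal (η/(2*π)) :=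
      (eLpNorm_le_eLpNorm_of_exponent_le (by norm_num) hm1).trans_lt hd
    have hint : Integrable (fun t => G t - F t) (AddCircle.haarAddCircle) := 
      memLp_one_iff_integrable.1 ⟨hm1, hd1.trans (by simp)⟩
    have h3 : ∫ t, ‖G t - F t‖ ∂AddCircle.haarAddCircle < η / (2*π) := by
      rw [eLpNorm_one_eq_lintegral_enorm, ← ofReal_integral_norm_eq_lintegral_enorm hint] at hd1
      exact (ENNReal.ofReal_lt_ofReal_iff (by positivity)).1 hd1
    rw [AddCircle.integral_haarAddCircle, ← AddCircle.intervalIntegral_preimage (2*π) 0, zero_add, smul_eq_mul, inv_mul_lt_iff₀ hp] at h3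
    have : 2 * π * (η / (2*π)) = η := by field_simp
    rw [this] at h3
    refine lt_of_eq_of_lt ?_ h3
    apply intervalIntegral.integral_congr_ae
    filter_upwards with x hx
    rw [uIoc_of_le hp.le] at hx
    rw [hFdef, AddCircle.liftIoc_coe_apply (by simpa using hx), hG]
    unfold tp
    congr 2
    refine Finset.sum_congr rfl fun k _ => ?_
    rw [fourier_coe_apply]
    congr 2
    have : (π:ℂ) ≠ 0 := by exact_mod_cast Real.pi_ne_zero
    push_cast
    field_simp
  · have hsq := hasSum_sq_fourierCoeffOn (lt_add_of_pos_right 0 hp) hL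
    have := sum_le_hasSum (Finset.Icc (-(n:ℤ)) n) (fun i _ => by positivity) hsq
    simp only [← fourierCoeff_liftIoc_eq] at this
    rw [sub_zero, zero_add, smul_eq_mul, le_inv_mul_iff₀ hp] at this
    refine this.trans (le_of_eq ?_)
    simp

lemma coef_bound (ε ρ A : ℝ) (hε : 0 < ε) (hρ : 0 < ρ) (Q : ℕ) (hQ : 1 ≤ Q)
    (c : ℕ → ℤ → ℂ) (hdis : ∀ s r k, c s k ≠ 0 → c r k ≠ 0 → s = r)
    (K : Finset ℤ) (hA : ∀ s, ∑ k ∈ K, ‖c s k‖^2 ≤ A * Q) (hAρ : A * Q ≤ (ρ * Q)^2) :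
    ∑ k ∈ K, ‖(Q:ℂ)⁻¹ * ∑ s ∈ Finset.range Q, c s k‖ ^ (2 + ε) ≤ ρ^ε * A := by
  have hQ0 : (0:ℝ) < Q := by exact_mod_cast hQ
  have key : ∀ k ∈ K, ‖(Q:ℂ)⁻¹ * ∑ s ∈ Finset.range Q, c s k‖ ^ (2 + ε) ≤
      ρ^ε * (((Q:ℝ)^2)⁻¹ * ∑ s ∈ Finset.range Q, ‖c s k‖^2) := by
    intro k hk
    by_cases h : ∃ s ∈ Finset.range Q, c s k ≠ 0
    · obtain ⟨s, hs, hsk⟩ := h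
      have e1 : ∑ r ∈ Finset.range Q, c r k = c s k := by
        refine Finset.sum_eq_single s (fun r _ hr => ?_) (fun h => absurd hs h)
        by_contra h; exact hr (hdis _ _ _ h hsk)
      have e2 : ‖c s k‖^2 ≤ ∑ s ∈ Finset.range Q, ‖c s k‖^2 :=
        Finset.single_le_sum (f := fun s => ‖c s k‖^2) (fun i _ => by positivity) hs
      have e3 : ‖c s k‖^2 ≤ (ρ * Q)^2 := by
        refine le_trans ?_ ((hA s).trans hAρ)
        exact Finset.single_le_sum (f := fun k => ‖c s k‖^2) (fun i _ => by positivity) hk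
      have e4 : ‖c s k‖ ≤ ρ * Q := by
        exact le_of_sq_le_sq e3 (by positivity)
      rw [e1, norm_mul, norm_inv, Complex.norm_natCast]
      have e5 : (Q:ℝ)⁻¹ * ‖c s k‖ ≤ ρ := by
        rw [inv_mul_le_iff₀ hQ0]; linarith
      rw [Real.rpow_add_of_nonneg (by positivity) (by norm_num) hε.le, mul_comm]
      have e6 : ((Q:ℝ)⁻¹ * ‖c s k‖) ^ (2:ℝ) = ((Q:ℝ)^2)⁻¹ * ‖c s k‖^2 := by
        rw [Real.rpow_two, mul_pow, inv_pow]
      rw [e6]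
      gcongr
    · push Not at h
      rw [Finset.sum_eq_zero h, mul_zero, norm_zero, Real.zero_rpow (by linarith)]
      positivity
  refine (Finset.sum_le_sum key).trans ?_
  rw [← Finset.mul_sum, ← Finset.mul_sum, Finset.sum_comm]
  have : ∑ s ∈ Finset.range Q, ∑ k ∈ K, ‖c s k‖^2 ≤ Q * (A * Q) := by
    refine (Finset.sum_le_sum fun s _ => hA s).trans ?_
    simp
  calc _ ≤ ρ^ε * (((Q:ℝ)^2)⁻¹ * (Q * (A*Q))) := by gcongr
    _ = _ := by field_simp

lemma combine (N₀ Q : ℕ) (hQ : 1 ≤ Q) (c : ℕ → ℤ → ℂ) (U : ℕ → ℕ) (hU : Monotone U) (hU0 : N₀ ≤ U 0)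
    (P : ℕ → ℝ → ℂ)
    (hs : ∀ s k, c s k ≠ 0 → (U s : ℤ) ≤ |k| ∧ |k| < U (s+1))
    (hP : ∀ s (K : Finset ℤ) x, (∀ k : ℤ, |k| < U (s+1) → k ∈ K) → tp K (c s) x = P s x) :
    (∀ x, tp ((Finset.Ioo (-(U Q:ℤ)) (U Q:ℤ)).filter (fun k => (N₀:ℤ) ≤ |k|))
      (fun k => (Q:ℂ)⁻¹ * ∑ s ∈ Finset.range Q, c s k) x = (Q:ℂ)⁻¹ * ∑ s ∈ Finset.range Q, P s x) ∧
    (∀ m : ℕ, m < U Q → N₀ ≤ m → ∃ r ≤ Q, ∃ r' : ℕ, ∀ x, 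
      ‖tp ((Finset.Icc (-(m:ℤ)) (m:ℤ)).filter (fun k => (N₀:ℤ) ≤ |k|))
      (fun k => (Q:ℂ)⁻¹ * ∑ s ∈ Finset.range Q, c s k) x‖ ≤ 
      (Q:ℝ)⁻¹ * (∑ s ∈ Finset.range r, ‖P s x‖ + ‖tp (Finset.Icc (-(m:ℤ)) (m:ℤ)) (c r') x‖)) := by
  have hfil : ∀ (K : Finset ℤ) x, tp (K.filter (fun k => (N₀:ℤ) ≤ |k|))
      (fun k => (Q:ℂ)⁻¹ * ∑ s ∈ Finset.range Q, c s k) x = 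
      (Q:ℂ)⁻¹ * ∑ s ∈ Finset.range Q, tp K (c s) x := by
    intro K x
    unfold tp
    rw [Finset.sum_filter_of_ne, Finset.sum_comm, Finset.mul_sum]
    · refine Finset.sum_congr rfl fun k _ => ?_
      rw [mul_assoc, Finset.sum_mul]
    · intro k _ hk
      have : ∑ s ∈ Finset.range Q, c s k ≠ 0 := by
        intro h; simp [h] at hk
      obtain ⟨s, _, h⟩ := Finset.exists_ne_zero_of_sum_ne_zero this
      have h1 := (hs s k h).1
      have h2 := hU (Nat.zero_le s)
      omega
  constructor
  · intro x
    rw [hfil]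
    congr 1
    refine Finset.sum_congr rfl fun s hsQ => hP s _ x ?_
    intro k hk
    have h2 := hU (Nat.succ_le_of_lt (Finset.mem_range.1 hsQ))
    simp only [Nat.succ_eq_add_one] at h2
    rw [Finset.mem_Ioo, ← abs_lt]
    omega
  · intro m hm hm0
    have hex : ∃ r, m < U (r+1) := ⟨Q-1, by rwa [Nat.sub_add_cancel (by omega)]⟩
    classical
    obtain ⟨r, hr, hmin⟩ : ∃ r, m < U (r+1) ∧ ∀ s < r, U (s+1) ≤ m :=
      ⟨Nat.find hex, Nat.find_spec hex, fun s h => by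
        have := Nat.find_min hex h; omega⟩
    have hrQ : r < Q := by
      by_contra h
      have := hmin (Q-1) (by omega)
      rw [Nat.sub_add_cancel (by omega)] at this
      omega
    refine ⟨r, hrQ.le, r, fun x => ?_⟩
    rw [hfil, norm_mul, norm_inv, Complex.norm_natCast]
    gcongr
    have e1 : ∑ s ∈ Finset.range Q, tp (Finset.Icc (-(m:ℤ)) (m:ℤ)) (c s) x = 
        ∑ s ∈ Finset.range (r+1), tp (Finset.Icc (-(m:ℤ)) (m:ℤ)) (c s) x := by
      symm
      apply Finset.sum_subset
      · intro s; simp only [Finset.mem_range]; omega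
      · intro s _ hsr
        rw [Finset.mem_range] at hsr
        unfold tp
        refine Finset.sum_eq_zero fun k hk => ?_
        have : c s k = 0 := by
          by_contra h
          have h1 := (hs s k h).1
          have h2 := hU (show r+1 ≤ s by omega)
          rw [Finset.mem_Icc, ← abs_le] at hk
          omega
        rw [this, zero_mul]
    rw [e1, Finset.sum_range_succ]
    refine (norm_add_le _ _).trans ?_
    gcongr
    refine (norm_sum_le _ _).trans (Finset.sum_le_sum fun s hsr => ?_)
    rw [hP s _ x]
    intro k hk
    have := hmin s (Finset.mem_range.1 hsr)
    rw [Finset.mem_Icc, ← abs_le]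
    omega

lemma exists_rho (ε A : ℝ) (hε : 0 < ε) (hA : 0 < A) : 
    ∃ ρ : ℝ, 0 < ρ ∧ ρ^ε * A < ε ∧ 2 * π * ρ < ε/4 := by
  have hp := Real.pi_pos
  refine ⟨min ((ε/(2*A))^(1/ε)) (ε/(16*π)), by positivity, ?_, ?_⟩
  · have h1 : (min ((ε/(2*A))^(1/ε)) (ε/(16*π)))^ε ≤ ((ε/(2*A))^(1/ε))^ε :=
      Real.rpow_le_rpow (by positivity) (min_le_left _ _) hε.le
    rw [← Real.rpow_mul (by positivity), one_div_mul_cancel hε.ne', Real.rpow_one] at h1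
    calc _ ≤ ε/(2*A) * A := by gcongr
      _ = ε/2 := by field_simp
      _ < ε := by linarith
  · calc _ ≤ 2 * π * (ε/(16*π)) := by gcongr; exact min_le_right _ _
      _ = ε/8 := by field_simp; norm_num
      _ < ε/4 := by linarith

/-- the block cut-offs -/
def Useq (n d N₀ : ℕ) : ℕ → ℕ
  | 0 => N₀
  | s+1 => n * (Useq n d N₀ s + d + 1) + d + 1 + Useq n d N₀ s

lemma Useq_lt (n d N₀ s : ℕ) : Useq n d N₀ s < Useq n d N₀ (s+1) := by
  rw [Useq]; omega

/-- L1 bound from L2 bound -/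
lemma l1_of_l2 (K : Finset ℤ) (c : ℤ → ℂ) (b : ℝ) (hb : 0 < b) (h : ∑ k ∈ K, ‖c k‖^2 ≤ b^2) :
    ∫ x in (0:ℝ)..(2*π), ‖tp K c x‖ ≤ 2 * π * b := by
  have hp := Real.pi_pos
  have hc := tp_cont K c
  have h1 : ∫ x in (0:ℝ)..(2*π), ‖tp K c x‖ ≤ ∫ x in (0:ℝ)..(2*π), ((2*b)⁻¹ * ‖tp K c x‖^2 + b/2) := by
    apply intervalIntegral.integral_mono_on (by positivity)
    · exact Continuous.intervalIntegrable (by fun_prop) _ _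
    · exact Continuous.intervalIntegrable (by fun_prop) _ _
    · intro x _
      have : (2*b)⁻¹ * ‖tp K c x‖^2 + b/2 - ‖tp K c x‖ = (2*b)⁻¹ * (‖tp K c x‖ - b)^2 := by
        field_simp; ring
      have h2 : 0 ≤ (2*b)⁻¹ * (‖tp K c x‖ - b)^2 := by positivity
      linarith
  refine h1.trans ?_
  rw [intervalIntegral.integral_add (Continuous.intervalIntegrable (by fun_prop) _ _)
    (Continuous.intervalIntegrable (by fun_prop) _ _), intervalIntegral.integral_const_mul, parseval]
  have h3 : (2*b)⁻¹ * (2 * π * ∑ k ∈ K, ‖c k‖^2) ≤ (2*b)⁻¹ * (2 * π * b^2) := by gcongr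
  have h4 : (2*b)⁻¹ * (2 * π * b^2) = π * b := by field_simp
  simp only [intervalIntegral.integral_const, smul_eq_mul]
  nlinarith

lemma phi_exists (D : ℝ) (h0 : 0 < D) (h1 : D < 1) (η : ℝ) (hη : 0 < η) :
    ∃ (n : ℕ) (a : ℤ → ℂ), (∀ k, a (-k) = starRingEnd ℂ (a k)) ∧ a 0 = 0 ∧
      (∫ x in (0:ℝ)..(2*π), ‖tp (Finset.Icc (-(n:ℤ)) n) a x - ((1 - wf D x / D : ℝ) : ℂ)‖) < η ∧
      ∑ k ∈ Finset.Icc (-(n:ℤ)) n, ‖a k‖^2 ≤ D⁻¹ := by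
  have hp := Real.pi_pos
  have hm := wf_meas D
  have hi := wf_int_able D 0 (2*π)
  obtain ⟨n, a, h2, h3, h4, h5⟩ := fourier_approx_s2 (fun x => 1 - wf D x / D) (by fun_prop) (1 + 1/D)
    (by
      intro x
      have : 0 < 1 / D := by positivity
      unfold wf
      split_ifs
      · rw [abs_le]; constructor <;> linarith
      · simp; positivity) η hη
  refine ⟨n, a, h2, ?_, h4, ?_⟩
  · rw [h3, intervalIntegral.integral_sub (by simp) (hi.div_const _), intervalIntegral.integral_div, wf_integral D h0 h1]
    have : (∫ x in (0:ℝ)..(2*π), (1:ℝ)) - 2 * π * D / D = 0 := by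
      simp; field_simp; simp
    rw [this]; simp
  · have e : ∀ x, (1 - wf D x / D)^2 = 1 + wf D x * ((D^2)⁻¹ - 2 / D) := by
      intro x
      unfold wf
      split_ifs
      · field_simp; ring
      · simp
    simp only [e] at h5
    rw [intervalIntegral.integral_add (by simp) (hi.mul_const _), intervalIntegral.integral_mul_const, wf_integral D h0 h1] at h5
    simp only [intervalIntegral.integral_const, smul_eq_mul] at h5
    have e2 : (2 * π - 0) * 1 + 2 * π * D * ((D^2)⁻¹ - 2 / D) = 2 * π * (D⁻¹ - 1) := by
      field_simp; ring
    rw [e2] at h5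
    have := le_of_mul_le_mul_left h5 (by positivity)
    linarith

lemma exc_measure (D : ℝ) (h0 : 0 < D) (h1 : D < 1) (ν : ℕ) (hν : 1 ≤ ν) :
    volume (Icc (0:ℝ) (2*π) ∩ {x : ℝ | wf D (ν * x) ≠ 0}) = ENNReal.ofReal (2 * π * D) := by
  have hp := Real.pi_pos
  obtain ⟨hi, he⟩ := per_int (wf_per D) (wf_int_able D _ _) ν hν
  rw [wf_integral D h0 h1, intervalIntegral.integral_of_le (by positivity), ← integral_Icc_eq_integral_Ioc] at he
  have hm : MeasurableSet {x : ℝ | wf D (ν * x) ≠ 0} := by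
    exact ((wf_meas D).comp (measurable_const_mul (ν:ℝ))) (measurableSet_singleton (0:ℝ)).compl
  have e : ∀ x, wf D (ν * x) = ({x : ℝ | wf D (ν * x) ≠ 0}).indicator (fun _ => (1:ℝ)) x := by
    intro x
    unfold Set.indicator wf
    simp only [Set.mem_ofPred_eq]
    split_ifs <;> simp_all
  rw [integral_congr_ae (Filter.Eventually.of_forall e)] at he
  rw [integral_indicator_const _ hm, smul_eq_mul, mul_one, Measure.real, Measure.restrict_apply hm, Set.inter_comm] at he
  rw [← he, ENNReal.ofReal_toReal]
  exact ne_top_of_le_ne_top (measure_Icc_lt_top (a := (0:ℝ)) (b := 2*π)).ne (measure_mono Set.inter_subset_left)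

lemma int_est (e : Set ℝ) (he : e ⊆ Icc 0 (2*π)) (hme : MeasurableSet e) (S : ℝ → ℂ) (f H : ℝ → ℝ)
    (hH0 : ∀ x, 0 ≤ H x) (hH : IntervalIntegrable H volume 0 (2*π)) (hf : IntegrableOn f (Icc 0 (2*π)))
    (hS : ∀ x ∈ e, ‖S x‖ ≤ H x + |f x|) :
    ∫ x in e, ‖S x‖ ≤ (∫ x in (0:ℝ)..(2*π), H x) + ∫ x in e, |f x| := by
  have hp : 0 ≤ 2 * π := by positivity
  rw [intervalIntegrable_iff_integrableOn_Icc_of_le hp] at hH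
  have hHe := hH.mono_set he
  have hfe : IntegrableOn (fun x => |f x|) e := (hf.mono_set he).abs
  rw [intervalIntegral.integral_of_le hp, ← integral_Icc_eq_integral_Ioc]
  calc ∫ x in e, ‖S x‖ ≤ ∫ x in e, (H x + |f x|) := by
        refine integral_mono_of_nonneg (Eventually.of_forall fun x => norm_nonneg _) (hHe.add hfe) ?_
        filter_upwards [ae_restrict_mem hme] with x hx
        exact hS x hx
    _ = (∫ x in e, H x) + ∫ x in e, |f x| := integral_add hHe hfe
    _ ≤ _ := by
        have := setIntegral_mono_set hH (Eventually.of_forall hH0) (HasSubset.Subset.eventuallyLE he)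
        linarith

theorem stmt2 (ε : ℝ) (hε : 0 < ε) (hε2 : ε < 1/2)
    (N₀ : ℕ) (hN₀ : 2 < N₀)
    (q : ℕ) (γ : ℕ → ℝ) (Δ : ℕ → Set ℝ)
    (hΔ : ∀ s ∈ Finset.range q, ∃ m i : ℕ, 1 ≤ i ∧ i ≤ 2^m ∧
      Δ s = Set.Icc (2*π*((i:ℝ)-1)/2^m) (2*π*(i:ℝ)/2^m))
    (f : ℝ → ℝ)
    (hf : ∀ x, f x = ∑ s ∈ Finset.range q, γ s * (Δ s).indicator (fun _ => (1:ℝ)) x)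
    (hγ : ∀ s ∈ Finset.range q,
      |γ s| * Real.sqrt ((volume (Δ s)).toReal) <
        ε^3 * (8 * ∫ x in Set.Icc (0:ℝ) (2*π), (f x)^2)⁻¹) :
    ∃ (E : Set ℝ) (N : ℕ) (C : ℤ → ℂ),
      MeasurableSet E ∧ E ⊆ Set.Icc 0 (2*π) ∧
      ENNReal.ofReal (2*π - ε) < volume E ∧
      N₀ < N ∧
      (∀ k : ℤ, C (-k) = starRingEnd ℂ (C k)) ∧
      (∫ x in E, ‖(∑ k ∈ (Finset.Ioo (-(N:ℤ)) (N:ℤ)).filter (fun k => (N₀:ℤ) ≤ |k|),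
          C k * Complex.exp (Complex.I * (k:ℂ) * (x:ℂ))) - (f x : ℂ)‖) < ε ∧
      (∑ k ∈ (Finset.Ioo (-(N:ℤ)) (N:ℤ)).filter (fun k => (N₀:ℤ) ≤ |k|),
          ‖C k‖ ^ (2 + ε)) < ε ∧
      (∀ m : ℕ, N₀ ≤ m → m < N → ∀ e ⊆ E, MeasurableSet e →
        (∫ x in e, ‖∑ k ∈ (Finset.Icc (-(m:ℤ)) (m:ℤ)).filter (fun k => (N₀:ℤ) ≤ |k|),
            C k * Complex.exp (Complex.I * (k:ℂ) * (x:ℂ))‖) < ε + ∫ x in e, |f x|) := by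

  have hp := Real.pi_pos
  have hp3 := Real.pi_gt_three
  have hΔm : ∀ s ∈ Finset.range q, MeasurableSet (Δ s) := by
    intro s hs
    obtain ⟨m, i, _, _, h⟩ := hΔ s hs
    rw [h]; exact measurableSet_Icc
  have hfm : Measurable f := by
    have : f = fun x => ∑ s ∈ Finset.range q, γ s * (Δ s).indicator (fun _ => (1:ℝ)) x := funext hf
    rw [this]
    exact Finset.measurable_fun_sum _ fun s hs =>
      measurable_const.mul (measurable_const.indicator (hΔm s hs))
  have hfb : ∀ x, |f x| ≤ ∑ s ∈ Finset.range q, |γ s| := by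
    intro x
    rw [hf x]
    refine (Finset.abs_sum_le_sum_abs _ _).trans (Finset.sum_le_sum fun s _ => ?_)
    rw [abs_mul]
    have : |(Δ s).indicator (fun _ => (1:ℝ)) x| ≤ 1 := by
      unfold Set.indicator; split_ifs <;> simp
    exact mul_le_of_le_one_right (abs_nonneg _) this
  have hfi : IntegrableOn f (Icc 0 (2*π)) := by
    refine Measure.integrableOn_of_bounded (M := ∑ s ∈ Finset.range q, |γ s|)
      (measure_Icc_lt_top).ne hfm.aestronglyMeasurable ?_
    filter_upwards with x using hfb x
  obtain ⟨d, t, ht, -, hT, -⟩ := fourier_approx_s2 f hfm _ hfb (ε/8) (by positivity)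
  set T := tp (Finset.Icc (-(d:ℤ)) d) t with hTdef
  have hTc : Continuous T := tp_cont _ _
  obtain ⟨M, hM0, hM⟩ : ∃ M : ℝ, 0 < M ∧ ∀ x, ‖T x‖ ≤ M :=
    ⟨1 + ∑ k ∈ Finset.Icc (-(d:ℤ)) d, ‖t k‖, by positivity, fun x => by
      have := tp_bound (Finset.Icc (-(d:ℤ)) d) t x
      linarith⟩
  set A := 4 * π * M^2 / ε with hA
  have hA0 : 0 < A := by positivity
  obtain ⟨ρ, hρ0, hρ1, hρ2⟩ := exists_rho ε A hε hA0
  obtain ⟨Q, hQ1, hQA⟩ : ∃ Q : ℕ, 1 ≤ Q ∧ A / ρ^2 ≤ Q :=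
    ⟨⌈A / ρ^2⌉₊ + 1, by omega, by push_cast; linarith [Nat.le_ceil (A / ρ^2)]⟩
  have hQ0 : (0:ℝ) < Q := by exact_mod_cast hQ1
  have hQ1' : (1:ℝ) ≤ Q := by exact_mod_cast hQ1
  have hAρ : A * Q ≤ (ρ * Q)^2 := by
    rw [div_le_iff₀ (by positivity)] at hQA
    nlinarith
  set D := ε / (4 * π * Q) with hD
  have hD0 : 0 < D := by positivity
  have hD1 : D < 1 := by
    rw [hD, div_lt_one (by positivity)]
    nlinarith
  obtain ⟨n, a, ha, ha0, hφ, hφ2⟩ := phi_exists D hD0 hD1 (ε/(8*M)) (by positivity)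
  set φ := tp (Finset.Icc (-(n:ℤ)) n) a with hφdef
  have hφc : Continuous φ := tp_cont _ _
  have hφp : Function.Periodic φ (2*π) := tp_per _ _
  set U := Useq n d N₀ with hU
  set ν : ℕ → ℕ := fun s => U s + d + 1 with hν
  have hν1 : ∀ s, 1 ≤ ν s := fun s => by simp only [hν]; omega
  choose c hc1 hc2 hc3 using fun s => block_s2 d n (ν s) t a ht ha ha0
  have hUs : ∀ s, (U (s+1) : ℤ) = n * (ν s) + d + 1 + U s := by
    intro s
    simp only [hU, hν, Useq]
    push_cast; ring
  have hUm : Monotone U := monotone_nat_of_le_succ fun s => (Useq_lt n d N₀ s).le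
  set P : ℕ → ℝ → ℂ := fun s x => T x * φ (ν s * x) with hP
  have hsup : ∀ s k, c s k ≠ 0 → (U s : ℤ) ≤ |k| ∧ |k| < U (s+1) := by
    intro s k h
    have h1 := hc2 s k h
    have h2 := hUs s
    have h3 : (ν s : ℤ) = U s + d + 1 := by simp [hν]
    constructor
    · omega
    · linarith [h1.2, Int.natCast_nonneg (U s)]
  have hcP : ∀ s (K : Finset ℤ) x, (∀ k : ℤ, |k| < U (s+1) → k ∈ K) → tp K (c s) x = P s x := by
    intro s K x hK
    refine hc3 s K x ?_
    intro k hk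
    apply hK
    rw [Finset.mem_Icc, ← abs_le] at hk
    have h2 := hUs s
    linarith [Int.natCast_nonneg (U s)]
  have hdis : ∀ s r k, c s k ≠ 0 → c r k ≠ 0 → s = r := by
    intro s r k h1 h2
    have h3 := hsup s k h1
    have h4 := hsup r k h2
    by_contra hne
    rcases lt_or_gt_of_ne hne with h | h
    · have := hUm (Nat.succ_le_of_lt h)
      simp only [Nat.succ_eq_add_one] at this
      omega
    · have := hUm (Nat.succ_le_of_lt h)
      simp only [Nat.succ_eq_add_one] at this
      omega
  have hL2 : ∀ s (K : Finset ℤ), ∑ k ∈ K, ‖c s k‖^2 ≤ A * Q := by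
    intro s K
    set K' := K ∪ Finset.Ioo (-(U (s+1):ℤ)) (U (s+1)) with hK'
    have h1 : ∑ k ∈ K, ‖c s k‖^2 ≤ ∑ k ∈ K', ‖c s k‖^2 :=
      Finset.sum_le_sum_of_subset_of_nonneg Finset.subset_union_left fun _ _ _ => by positivity
    refine h1.trans ?_
    have h2 := parseval K' (c s)
    have h3 : ∀ x, tp K' (c s) x = P s x := fun x => hcP s K' x fun k hk => by
      rw [hK', Finset.mem_union, Finset.mem_Ioo, ← abs_lt]; exact Or.inr hk
    simp only [h3] at h2
    have hper : Function.Periodic (fun x => ‖φ x‖^2) (2*π) := fun x => by simp only [hφp x]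
    obtain ⟨h4, h5⟩ := per_int hper (Continuous.intervalIntegrable (by fun_prop) _ _) (ν s) (hν1 s)
    have h6 : ∫ x in (0:ℝ)..(2*π), ‖P s x‖^2 ≤ ∫ x in (0:ℝ)..(2*π), M^2 * ‖φ (ν s * x)‖^2 := by
      apply intervalIntegral.integral_mono_on (by positivity)
      · exact Continuous.intervalIntegrable (by simp only [hP]; fun_prop) _ _
      · exact h4.const_mul _
      · intro x _
        simp only [hP]
        rw [norm_mul, mul_pow]
        gcongr
        exact hM x
    rw [h2, intervalIntegral.integral_const_mul, h5, hφdef, parseval] at h6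
    have h7 : M^2 * (2 * π * ∑ k ∈ Finset.Icc (-(n:ℤ)) n, ‖a k‖^2) ≤ M^2 * (2 * π * D⁻¹) := by gcongr
    have h8 : M^2 * (2 * π * D⁻¹) = 2 * π * (A * Q) := by
      rw [hA, hD]; field_simp
    exact le_of_mul_le_mul_left (h6.trans (h7.trans h8.le)) (by positivity)
  obtain ⟨hfull, hpart⟩ := combine N₀ Q hQ1 c U hUm (by rw [hU, Useq]) P hsup hcP
  set B : ℕ → Set ℝ := fun s => {x : ℝ | wf D (ν s * x) ≠ 0} with hB
  have hBm : ∀ s, MeasurableSet (B s) := fun s =>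
    ((wf_meas D).comp (measurable_const_mul (ν s:ℝ))) (measurableSet_singleton (0:ℝ)).compl
  set E : Set ℝ := Icc (0:ℝ) (2*π) \ ⋃ s ∈ Finset.range Q, B s with hE
  have hEs : E ⊆ Icc 0 (2*π) := Set.sdiff_subset
  have hEm : MeasurableSet E :=
    measurableSet_Icc.diff (Finset.measurableSet_biUnion _ fun s _ => hBm s)
  set G : ℕ → ℝ → ℝ := fun s x => ‖φ (ν s * x) - ((1 - wf D (ν s * x) / D : ℝ) : ℂ)‖ with hG
  have hGi : ∀ s, IntervalIntegrable (G s) volume 0 (2*π) ∧ ∫ x in (0:ℝ)..(2*π), G s x < ε/(8*M) := by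
    intro s
    have hper : Function.Periodic (fun x => ‖φ x - ((1 - wf D x / D : ℝ) : ℂ)‖) (2*π) := fun x => by
      simp only [hφp x, wf_per D x]
    have hint : IntervalIntegrable (fun x => ‖φ x - ((1 - wf D x / D : ℝ) : ℂ)‖) volume 0 (2*π) := by
      refine IntervalIntegrable.norm ?_
      refine (hφc.intervalIntegrable _ _).sub ?_
      have h1 : IntervalIntegrable (fun x => 1 - wf D x / D) volume 0 (2*π) :=
        (intervalIntegrable_const).sub ((wf_int_able D _ _).div_const _)
      exact ⟨h1.1.ofReal, h1.2.ofReal⟩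
    obtain ⟨h4, h5⟩ := per_int hper hint (ν s) (hν1 s)
    exact ⟨h4, by simp only [hG]; rw [h5]; exact hφ⟩
  have hPT : ∀ x ∈ E, ∀ s < Q, ‖P s x - T x‖ ≤ M * G s x := by
    intro x hx s hs
    have hxB : wf D (ν s * x) = 0 := by
      by_contra h
      apply hx.2
      simp only [Set.mem_iUnion]
      exact ⟨s, Finset.mem_range.2 hs, h⟩
    have : P s x - T x = T x * (φ (ν s * x) - ((1 - wf D (ν s * x) / D : ℝ) : ℂ)) := by
      rw [hxB]; simp only [hP]; push_cast; ring
    rw [this, norm_mul]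
    simp only [hG]
    gcongr
    exact hM x
  set H : ℝ → ℝ := fun x => (Q:ℝ)⁻¹ * ∑ s ∈ Finset.range Q, M * G s x + ‖T x - (f x : ℂ)‖ with hH
  have hG0 : ∀ s x, 0 ≤ G s x := fun s x => norm_nonneg _
  have hH0 : ∀ x, 0 ≤ H x := by
    intro x
    have := Finset.sum_nonneg (s := Finset.range Q) (f := fun s => M * G s x) fun s _ => mul_nonneg hM0.le (hG0 s x)
    simp only [hH]; positivity
  have hTfi : IntervalIntegrable (fun x => ‖T x - (f x : ℂ)‖) volume 0 (2*π) := by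
    refine IntervalIntegrable.norm ((hTc.intervalIntegrable _ _).sub ?_)
    rw [intervalIntegrable_iff_integrableOn_Icc_of_le (by positivity)]
    exact hfi.ofReal
  have hsumi : IntervalIntegrable (fun x => ∑ s ∈ Finset.range Q, M * G s x) volume 0 (2*π) := by
    have := IntervalIntegrable.sum (Finset.range Q) (f := fun s x => M * G s x) (μ := volume) (a := 0) (b := 2*π)
      fun s _ => (hGi s).1.const_mul M
    have e : (fun x => ∑ s ∈ Finset.range Q, M * G s x) = ∑ s ∈ Finset.range Q, fun x => M * G s x := by
      funext x; simp
    rw [e]; exact this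
  have hHi : IntervalIntegrable H volume 0 (2*π) := (hsumi.const_mul _).add hTfi
  have hHb : ∫ x in (0:ℝ)..(2*π), H x < ε/4 := by
    simp only [hH]
    rw [intervalIntegral.integral_add (hsumi.const_mul _) hTfi, intervalIntegral.integral_const_mul,
      intervalIntegral.integral_finsetSum fun s _ => (hGi s).1.const_mul M]
    have h1 : ∑ s ∈ Finset.range Q, ∫ x in (0:ℝ)..(2*π), M * G s x ≤ Q * (ε/8) := by
      have : ∀ s ∈ Finset.range Q, ∫ x in (0:ℝ)..(2*π), M * G s x ≤ ε/8 := by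
        intro s _
        rw [intervalIntegral.integral_const_mul]
        calc _ ≤ M * (ε/(8*M)) := by gcongr; exact (hGi s).2.le
          _ = ε/8 := by field_simp
      refine (Finset.sum_le_sum this).trans ?_
      simp
    have h2 : (Q:ℝ)⁻¹ * ∑ s ∈ Finset.range Q, ∫ x in (0:ℝ)..(2*π), M * G s x ≤ ε/8 := by
      rw [inv_mul_le_iff₀ hQ0]; exact h1
    linarith
  refine ⟨E, U Q, fun k => (Q:ℂ)⁻¹ * ∑ s ∈ Finset.range Q, c s k, hEm, hEs, ?_, ?_, ?_, ?_, ?_, ?_⟩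
  · have h1 : volume (Icc (0:ℝ) (2*π)) ≤ volume E + ∑ s ∈ Finset.range Q, volume (Icc (0:ℝ) (2*π) ∩ B s) := by
      have hsub : Icc (0:ℝ) (2*π) ⊆ E ∪ ⋃ s ∈ Finset.range Q, (Icc (0:ℝ) (2*π) ∩ B s) := by
        intro x hx
        by_cases h : x ∈ ⋃ s ∈ Finset.range Q, B s
        · right
          simp only [Set.mem_iUnion] at h ⊢
          obtain ⟨s, hs, h⟩ := h
          exact ⟨s, hs, hx, h⟩
        · exact Or.inl ⟨hx, h⟩
      refine (measure_mono hsub).trans ((measure_union_le _ _).trans ?_)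
      gcongr
      exact measure_biUnion_finset_le _ _
    have h2 : ∑ s ∈ Finset.range Q, volume (Icc (0:ℝ) (2*π) ∩ B s) = ENNReal.ofReal (ε/2) := by
      have : ∀ s ∈ Finset.range Q, volume (Icc (0:ℝ) (2*π) ∩ B s) = ENNReal.ofReal (2*π*D) :=
        fun s _ => exc_measure D hD0 hD1 (ν s) (hν1 s)
      rw [Finset.sum_congr rfl this, Finset.sum_const, Finset.card_range, nsmul_eq_mul,
        ← ENNReal.ofReal_natCast, ← ENNReal.ofReal_mul hQ0.le]
      congr 1
      rw [hD]; field_simp; norm_num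
    rw [h2, Real.volume_Icc, sub_zero] at h1
    by_contra hcon
    push Not at hcon
    have h3 : ENNReal.ofReal (2*π) ≤ ENNReal.ofReal (2*π - ε) + ENNReal.ofReal (ε/2) :=
      h1.trans (by gcongr)
    rw [← ENNReal.ofReal_add (by linarith) (by linarith), ENNReal.ofReal_le_ofReal_iff (by linarith)] at h3
    linarith
  · have : U 0 < U 1 := Useq_lt n d N₀ 0
    have h2 := hUm hQ1
    have h3 : U 0 = N₀ := rfl
    omega
  · intro k
    simp only [map_mul, map_sum, hc1, map_inv₀, map_natCast]
  · have := int_est E hEs hEm (fun x => (Q:ℂ)⁻¹ * ∑ s ∈ Finset.range Q, P s x - (f x : ℂ)) (fun _ => 0) H hH0 hHi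
      (by simp) (by
        intro x hx
        have e : (Q:ℂ)⁻¹ * ∑ s ∈ Finset.range Q, P s x - (f x : ℂ) =
            (Q:ℂ)⁻¹ * ∑ s ∈ Finset.range Q, (P s x - T x) + (T x - (f x : ℂ)) := by
          have : (Q:ℂ) ≠ 0 := by exact_mod_cast hQ0.ne'
          rw [Finset.sum_sub_distrib, Finset.sum_const, Finset.card_range, nsmul_eq_mul]
          field_simp; ring
        simp only [e, hH, abs_zero, add_zero]
        refine (norm_add_le _ _).trans ?_
        rw [norm_mul, norm_inv, Complex.norm_natCast]
        gcongr
        exact (norm_sum_le _ _).trans (Finset.sum_le_sum fun s hs => hPT x hx s (Finset.mem_range.1 hs)))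
    simp only [← hfull] at this
    unfold tp at this
    refine lt_of_le_of_lt this ?_
    simp
    linarith
  · exact lt_of_le_of_lt (coef_bound ε ρ A hε hρ0 Q hQ1 c hdis _ (fun s => hL2 s _) hAρ) hρ1
  · intro m hm0 hmN e he hem
    obtain ⟨r, hrQ, r', hr⟩ := hpart m hmN hm0
    set R := tp (Finset.Icc (-(m:ℤ)) (m:ℤ)) (c r') with hR
    have hRc : Continuous R := tp_cont _ _
    have hRi : IntervalIntegrable (fun x => (Q:ℝ)⁻¹ * ‖R x‖) volume 0 (2*π) :=
      Continuous.intervalIntegrable (by fun_prop) _ _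
    have hRb : ∫ x in (0:ℝ)..(2*π), (Q:ℝ)⁻¹ * ‖R x‖ ≤ 2 * π * ρ := by
      rw [intervalIntegral.integral_const_mul, inv_mul_le_iff₀ hQ0]
      have := l1_of_l2 (Finset.Icc (-(m:ℤ)) (m:ℤ)) (c r') (ρ * Q) (by positivity) ((hL2 _ _).trans hAρ)
      linarith
    have := int_est e (he.trans hEs) hem _ f (fun x => H x + (Q:ℝ)⁻¹ * ‖R x‖)
      (fun x => add_nonneg (hH0 x) (by positivity)) (hHi.add hRi) hfi (by
        intro x hx
        refine (hr x).trans ?_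
        have h1 : ∑ s ∈ Finset.range r, ‖P s x‖ ≤ ∑ s ∈ Finset.range Q, (M * G s x + ‖T x‖) := by
          calc _ ≤ ∑ s ∈ Finset.range r, (M * G s x + ‖T x‖) := by
                refine Finset.sum_le_sum fun s hs => ?_
                have h2 := hPT x (he hx) s (lt_of_lt_of_le (Finset.mem_range.1 hs) hrQ)
                have h3 := norm_le_norm_sub_add (P s x) (T x)
                linarith
            _ ≤ _ := by
                refine Finset.sum_le_sum_of_subset_of_nonneg (Finset.range_mono hrQ) fun s _ _ => ?_
                have := mul_nonneg hM0.le (hG0 s x)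
                positivity
        rw [Finset.sum_add_distrib, Finset.sum_const, Finset.card_range, nsmul_eq_mul] at h1
        have h4 : ‖T x‖ ≤ ‖T x - (f x : ℂ)‖ + |f x| := by
          have := norm_le_norm_sub_add (T x) (f x : ℂ)
          rwa [Complex.norm_real, Real.norm_eq_abs] at this
        calc _ ≤ (Q:ℝ)⁻¹ * (∑ s ∈ Finset.range Q, M * G s x + Q * ‖T x‖ + ‖R x‖) := by gcongr
          _ = (Q:ℝ)⁻¹ * ∑ s ∈ Finset.range Q, M * G s x + ‖T x‖ + (Q:ℝ)⁻¹ * ‖R x‖ := by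
            field_simp
          _ ≤ _ := by simp only [hH]; linarith)
    rw [intervalIntegral.integral_add hHi hRi] at this
    unfold tp at this
    refine lt_of_le_of_lt this ?_
    linarith
end
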